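/- Let R be a commutative ring of finite Krull dimension d and A = R[Y] the polynomial ring in one variable over R. Let P be a finitely generated projective A-module of constant rank r ≥ d+1 which satisfies property Ω(R). Then P is cancellative: for every finitely generated projective A-module Q and every t ∈ ℕ, if P ⊕ A^t ≅ Q ⊕ A^t then P ≅ Q. -/

import Mathlib

open Polynomial

/-- An element `m` of an `A`-module `M` is unimodular if some linear functional sends it to `1`. -/
def IsUnimodular (A : Type*) [CommRing A] (M : Type*) [AddCommGroup M] [Module A M]
    (m : M) : Prop :=
  ∃ φ : M →ₗ[A] A, φ m = 1

/-- `E(M)`: the subgroup of `Aut_A(M)` generated by transvections, i.e. automorphisms of the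
form `q ↦ q + φ(q) • p` with `φ(p) = 0` and `p` unimodular or `φ` unimodular. -/
def TransvectionGroup (A : Type*) [CommRing A] (M : Type*) [AddCommGroup M] [Module A M] :
    Subgroup (M ≃ₗ[A] M) :=
  Subgroup.closure {σ : M ≃ₗ[A] M | ∃ (p : M) (φ : M →ₗ[A] A), φ p = 0 ∧
    (IsUnimodular A M p ∨ IsUnimodular A (M →ₗ[A] A) φ) ∧ ∀ q : M, σ q = q + φ q • p}

/-- A projective module has constant rank `r` if its localization at every prime is free of
rank `r`. -/
def HasConstantRank (A : Type*) [CommRing A] (P : Type*) [AddCommGroup P] [Module A P]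
    (r : ℕ) : Prop :=
  ∀ (𝔭 : Ideal A) (h𝔭 : 𝔭.IsPrime),
    haveI := h𝔭
    Module.Free (Localization.AtPrime 𝔭) (LocalizedModule 𝔭.primeCompl P) ∧
    Module.finrank (Localization.AtPrime 𝔭) (LocalizedModule 𝔭.primeCompl P) = r

/-- Property `Ω(R)` for a projective module `P` over an `R`-algebra `S`. -/
def PropertyOmega (R : Type*) [CommRing R] (S : Type*) [CommRing S] [Algebra R S]
    (P : Type*) [AddCommGroup P] [Module S P] : Prop :=
  ∀ I : Ideal R, ∃ t : R,
    Ideal.Quotient.mk I t ∈ nonZeroDivisors (R ⧸ I) ∧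
    Module.Free
      (Localization (Submonoid.powers
        (Ideal.Quotient.mk (I.map (algebraMap R S)) (algebraMap R S t))))
      (LocalizedModule (Submonoid.powers
        (Ideal.Quotient.mk (I.map (algebraMap R S)) (algebraMap R S t)))
        (P ⧸ ((I.map (algebraMap R S)) • ⊤ : Submodule S P)))

namespace YC
set_option linter.unusedSectionVars false

def El (n : Type*) [Fintype n] [DecidableEq n] (D : Type*) [CommRing D] :
    Submonoid (Matrix n n D) :=
  Submonoid.closure {M | ∃ (i j : n) (c : D), i ≠ j ∧ M = Matrix.transvection i j c}

def Rq {n : Type*} [Fintype n] [DecidableEq n] {D : Type*} [CommRing D] (v w : n → D) : Prop :=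
  ∃ g ∈ El n D, g.mulVec v = w

def Um {n : Type*} [Fintype n] {D : Type*} [CommRing D] (v : n → D) : Prop :=
  ∃ c : n → D, ∑ i, c i * v i = 1

section basics
variable {n : Type*} [Fintype n] [DecidableEq n] {D : Type*} [CommRing D]
  {D' : Type*} [CommRing D']

lemma trans_mem {i j : n} (h : i ≠ j) (c : D) : Matrix.transvection i j c ∈ El n D :=
  Submonoid.subset_closure ⟨i, j, c, h, rfl⟩

lemma trans_inv {i j : n} (h : i ≠ j) (c : D) :
    Matrix.transvection i j c * Matrix.transvection i j (-c) = 1 := by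
  rw [Matrix.transvection_mul_transvection_same _ _ h]; simp

lemma trans_inv' {i j : n} (h : i ≠ j) (c : D) :
    Matrix.transvection i j (-c) * Matrix.transvection i j c = 1 := by
  rw [Matrix.transvection_mul_transvection_same _ _ h]; simp

lemma El_inv {g : Matrix n n D} (hg : g ∈ El n D) :
    ∃ h ∈ El n D, g * h = 1 ∧ h * g = 1 := by
  induction hg using Submonoid.closure_induction with
  | mem x hx =>
    obtain ⟨i, j, c, hij, rfl⟩ := hx
    exact ⟨_, trans_mem hij (-c), trans_inv hij c, trans_inv' hij c⟩
  | one => exact ⟨1, one_mem _, by simp, by simp⟩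
  | mul x y _ _ hx hy =>
    obtain ⟨a, ha, ha1, ha2⟩ := hx
    obtain ⟨b, hb, hb1, hb2⟩ := hy
    refine ⟨b * a, mul_mem hb ha, ?_, ?_⟩
    · calc x * y * (b * a) = x * (y * b) * a := by simp only [mul_assoc]
        _ = 1 := by rw [hb1, mul_one, ha1]
    · calc b * a * (x * y) = b * (a * x) * y := by simp only [mul_assoc]
        _ = 1 := by rw [ha2, mul_one, hb2]

lemma map_trans (f : D →+* D') (i j : n) (c : D) :
    f.mapMatrix (Matrix.transvection i j c) = Matrix.transvection i j (f c) := by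
  rw [Matrix.transvection, Matrix.transvection, map_add, map_one]
  congr 1
  ext a b
  simp [Matrix.single_apply, apply_ite f]

lemma El_map (f : D →+* D') {g : Matrix n n D} (hg : g ∈ El n D) :
    f.mapMatrix g ∈ El n D' := by
  induction hg using Submonoid.closure_induction with
  | mem x hx =>
    obtain ⟨i, j, c, hij, rfl⟩ := hx
    rw [map_trans]
    exact trans_mem hij _
  | one => rw [map_one]; exact one_mem _
  | mul x y _ _ hx hy => rw [map_mul]; exact mul_mem hx hy

lemma Rq.refl (v : n → D) : Rq v v := ⟨1, one_mem _, by simp⟩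
lemma Rq.trans {u v w : n → D} (h1 : Rq u v) (h2 : Rq v w) : Rq u w := by
  obtain ⟨g, hg, rfl⟩ := h1
  obtain ⟨h, hh, rfl⟩ := h2
  exact ⟨h * g, mul_mem hh hg, by simp [Matrix.mulVec_mulVec]⟩
lemma Rq.symm {v w : n → D} (h1 : Rq v w) : Rq w v := by
  obtain ⟨g, hg, rfl⟩ := h1
  obtain ⟨h, hh, _, h2⟩ := El_inv hg
  exact ⟨h, hh, by simp [Matrix.mulVec_mulVec, h2]⟩

lemma map_mulVec' (f : D →+* D') (g : Matrix n n D) (v : n → D) :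
    (f.mapMatrix g).mulVec (f ∘ v) = f ∘ (g.mulVec v) := by
  ext i; simp [Matrix.mulVec, dotProduct]

lemma Rq.map (f : D →+* D') {v w : n → D} (h1 : Rq v w) : Rq (f ∘ v) (f ∘ w) := by
  obtain ⟨g, hg, rfl⟩ := h1
  exact ⟨_, El_map f hg, map_mulVec' _ _ _⟩

lemma trans_mulVec (i j : n) (c : D) (v : n → D) :
    (Matrix.transvection i j c).mulVec v = Function.update v i (v i + c * v j) := by
  ext a
  rw [Matrix.transvection, Matrix.add_mulVec, Matrix.one_mulVec, Pi.add_apply,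
    Matrix.single_mulVec]
  by_cases h : a = i
  · subst h; simp
  · simp [h]

lemma Rq.step {i j : n} (h : i ≠ j) (c : D) (v : n → D) :
    Rq v (Function.update v i (v i + c * v j)) :=
  ⟨_, trans_mem h c, trans_mulVec _ _ _ _⟩

/-- induction principle for row equivalence -/
lemma Rq.induct {motive : (n → D) → Prop} {v w : n → D} (h : Rq v w) (h0 : motive v)
    (hs : ∀ (u : n → D) (i j : n) (c : D), i ≠ j → motive u →
      motive (Function.update u i (u i + c * u j))) : motive w := by
  obtain ⟨g, hg, rfl⟩ := h
  induction hg using Submonoid.closure_induction generalizing v with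
  | mem x hx =>
    obtain ⟨i, j, c, hij, rfl⟩ := hx
    rw [trans_mulVec]; exact hs _ _ _ _ hij h0
  | one => simpa using h0
  | mul x y _ _ hx hy =>
    rw [← Matrix.mulVec_mulVec]
    exact hx (hy h0)

lemma Rq.multi (i : n) (s : Finset n) (hs : i ∉ s) (c : n → D) (v : n → D) :
    Rq v (Function.update v i (v i + ∑ j ∈ s, c j * v j)) := by
  induction s using Finset.induction_on with
  | empty => simpa using Rq.refl v
  | insert a s ha ih =>
    have hia : i ≠ a := by rintro rfl; simp at hs
    refine (ih (by simp_all)).trans ?_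
    convert Rq.step hia (c a) _ using 1
    ext b
    by_cases hb : b = i
    · subst hb; simp [Finset.sum_insert ha, hia.symm]; ring
    · simp [hb]

lemma Rq.pour (j : n) (s : Finset n) (hs : j ∉ s) (c : n → D) (v : n → D) :
    Rq v (fun i => if i ∈ s then v i + c i * v j else v i) := by
  induction s using Finset.induction_on with
  | empty => simpa using Rq.refl v
  | insert a s ha ih =>
    have hia : a ≠ j := by rintro rfl; simp at hs
    have hjs : j ∉ s := by simp_all
    refine (ih hjs).trans ?_
    convert Rq.step hia (c a) _ using 1
    ext b
    by_cases hb : b = a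
    · subst hb; simp [ha, hjs]
    · simp [hb]

lemma Um.rq {v w : n → D} (hv : Um v) (h : Rq v w) : Um w := by
  obtain ⟨g, hg, hgw⟩ := h.symm
  obtain ⟨c, hc⟩ := hv
  refine ⟨Matrix.vecMul c g, ?_⟩
  have := Matrix.dotProduct_mulVec c g w
  rw [hgw] at this
  exact this.symm.trans hc

lemma Um.map (f : D →+* D') {v : n → D} (hv : Um v) : Um (f ∘ v) := by
  obtain ⟨c, hc⟩ := hv
  refine ⟨f ∘ c, ?_⟩
  simpa using congrArg f hc

end basics

section dim

lemma dim_succ_le {C : Type*} [CommRing C] (N : Ideal C)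
    (hN : ∀ p ∈ minimalPrimes C, ¬ N ≤ p) :
    ringKrullDim (C ⧸ N) + 1 ≤ ringKrullDim C := by
  by_cases hr' : N = ⊤
  · have := Ideal.Quotient.subsingleton_iff.mpr hr'
    rw [ringKrullDim_eq_bot_of_subsingleton]
    simp
  have : Nonempty (PrimeSpectrum.zeroLocus (R := C) N) := by
    rwa [Set.nonempty_coe_sort, Set.nonempty_iff_ne_empty, ne_eq,
      PrimeSpectrum.zeroLocus_empty_iff_eq_top]
  have := Ideal.Quotient.nontrivial_iff.mpr hr'
  have := (Ideal.Quotient.mk N).domain_nontrivial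
  rw [ringKrullDim_quotient, Order.krullDim_eq_iSup_length, ringKrullDim,
    Order.krullDim_eq_iSup_length, ← WithBot.coe_one, ← WithBot.coe_add,
    ENat.iSup_add, WithBot.coe_le_coe, iSup_le_iff]
  intro l
  obtain ⟨p, hp, hp'⟩ := Ideal.exists_minimalPrimes_le (J := l.head.1.asIdeal) bot_le
  let p' : PrimeSpectrum C := ⟨p, hp.1.1⟩
  have hp' : p' < l.head := lt_of_le_of_ne hp' fun h ↦ hN p hp (by
    have := l.head.2
    rw [PrimeSpectrum.mem_zeroLocus, ← h] at this
    exact this)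
  refine le_trans ?_ (le_iSup _ ((l.map Subtype.val (fun _ _ ↦ id)).cons p' hp'))
  exact le_of_eq (by norm_cast; exact (RelSeries.cons_length (l.map Subtype.val (fun _ _ ↦ id)) p' hp').symm)

lemma lt_of_succ_le {x y : WithBot ℕ∞} {n : ℕ} (h : x + 1 ≤ y) (hy : y < (n + 1 : ℕ)) :
    x < (n : ℕ) := by
  have h1 : x + 1 < (n + 1 : ℕ) := lt_of_le_of_lt h hy
  induction x with
  | bot => exact WithBot.bot_lt_coe _
  | coe x =>
    induction x with
    | top =>
      exfalso
      revert h1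
      exact not_lt.mpr (by exact le_top)
    | coe x =>
      norm_cast at h1 ⊢
      omega


theorem SR (n : ℕ) : ∀ (C : Type*) [CommRing C], ringKrullDim C < (n : ℕ) →
    ∀ (a : C) (b : Fin n → C), (∃ c0, ∃ c : Fin n → C, c0 * a + ∑ i, c i * b i = 1) →
    ∃ x : Fin n → C, Um (fun i => b i + a * x i) := by
  induction n with
  | zero =>
    intro C _ hC a b _
    have : Subsingleton C := by
      by_contra h
      rw [not_subsingleton_iff_nontrivial] at h
      have := ringKrullDim_nonneg_of_nontrivial (R := C)
      exact absurd hC (not_lt.mpr (by simpa using this))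
    exact ⟨b, b, Subsingleton.elim _ _⟩
  | succ n ih =>
    intro C _ hC a b ⟨c0, c, hc⟩
    let K : Ideal C := Submodule.comap (LinearMap.lsmul C C (b 0)) (nilradical C)
    have hK : ∀ y, y ∈ K ↔ IsNilpotent (b 0 * y) := fun y => by
      simp [K, mem_nilradical]
    let N : Ideal C := Ideal.span {b 0} ⊔ K
    have hdim : ringKrullDim (C ⧸ N) < (n : ℕ) := by
      refine lt_of_succ_le (dim_succ_le N ?_) hC
      intro p hp hle
      have hpp : p.IsPrime := hp.1.1
      have hb : b 0 ∈ p := hle (Ideal.mem_sup_left (Ideal.mem_span_singleton_self _))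
      have h1 : algebraMap C (Localization.AtPrime p) (b 0) ∈
          ((⊥ : Ideal C).map (algebraMap C (Localization.AtPrime p))).radical := by
        rw [IsLocalization.AtPrime.radical_map_of_mem_minimalPrimes
          (Localization.AtPrime p) p ⊥ hp]
        exact Ideal.mem_map_of_mem _ hb
      rw [Ideal.map_bot] at h1
      obtain ⟨k, hk⟩ := h1
      rw [Ideal.mem_bot, ← map_pow] at hk
      obtain ⟨t, ht⟩ := (IsLocalization.map_eq_zero_iff p.primeCompl _ _).mp hk
      refine t.2 (hle (Ideal.mem_sup_right ((hK _).mpr ⟨k + 1, ?_⟩)))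
      calc (b 0 * (t : C)) ^ (k + 1) = (t * b 0 ^ k) * (b 0 * (t:C) ^ k) := by ring
        _ = 0 := by rw [ht, zero_mul]
    obtain ⟨x, c', hx⟩ := ih (C ⧸ N) hdim (Ideal.Quotient.mk N a)
      (fun i => Ideal.Quotient.mk N (b i.succ)) ⟨Ideal.Quotient.mk N c0,
        fun i => Ideal.Quotient.mk N (c i.succ), by
          have := congrArg (Ideal.Quotient.mk N) hc
          rw [Fin.sum_univ_succ] at this
          have hb : Ideal.Quotient.mk N (b 0) = 0 := Ideal.Quotient.eq_zero_iff_mem.mpr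
            (Ideal.mem_sup_left (Ideal.mem_span_singleton_self _))
          simpa [hb] using this⟩
    choose X hX using fun i => Ideal.Quotient.mk_surjective (x i)
    choose Z hZ using fun i => Ideal.Quotient.mk_surjective (c' i)
    have hmem : 1 - ∑ i, Z i * (b i.succ + a * X i) ∈ N := by
      rw [← Ideal.Quotient.eq_zero_iff_mem]
      simp only [map_sub, map_sum, map_mul, map_add, hX, hZ, map_one]
      rw [hx, sub_self]
    obtain ⟨w, hw, y, hy, hwy⟩ := Submodule.mem_sup.mp hmem
    rw [hK] at hy
    refine ⟨Fin.cons y X, ?_⟩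
    set b' : Fin (n+1) → C := fun i => b i + a * (Fin.cons y X : Fin (n+1) → C) i with hb'
    suffices h : (1 : C) ∈ Ideal.span (Set.range b') by
      exact (Ideal.mem_span_range_iff_exists_fun).mp h
    rw [← Ideal.eq_top_iff_one]
    by_contra hne
    obtain ⟨m, hm, hle⟩ := Ideal.exists_le_maximal _ hne
    have hmp := hm.isPrime
    have hbm : ∀ i, b' i ∈ m := fun i => hle (Ideal.subset_span ⟨i, rfl⟩)
    have h0 : b 0 + a * y ∈ m := by simpa [hb'] using hbm 0
    have hs : ∀ i : Fin n, b i.succ + a * X i ∈ m := fun i => by simpa [hb'] using hbm i.succ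
    have hby : b 0 * y ∈ m := by
      obtain ⟨k, hk⟩ := hy
      exact hmp.mem_of_pow_mem k (by rw [hk]; exact zero_mem _)
    have hsum : ∑ i, Z i * (b i.succ + a * X i) ∈ m :=
      Ideal.sum_mem _ fun i _ => Ideal.mul_mem_left _ _ (hs i)
    have key : ¬ (b 0 ∈ m ∧ y ∈ m) := by
      rintro ⟨h1, h2⟩
      apply hmp.ne_top
      rw [Ideal.eq_top_iff_one]
      have hw' : w ∈ m := (Ideal.span_singleton_le_iff_mem _).mpr h1 hw
      have := add_mem (add_mem hw' h2) hsum
      rwa [hwy, sub_add_cancel] at this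
    have hbb : b 0 ∈ m := by
      rcases hmp.mem_or_mem hby with h | h
      · exact h
      · exact (Ideal.add_mem_iff_left _ (Ideal.mul_mem_left _ _ h)).mp h0
    have hay : a * y ∈ m := (Ideal.add_mem_iff_right _ hbb).mp h0
    rcases hmp.mem_or_mem hay with h | h
    · apply hmp.ne_top
      rw [Ideal.eq_top_iff_one, ← hc, Fin.sum_univ_succ]
      refine add_mem (Ideal.mul_mem_left _ _ h) (add_mem (Ideal.mul_mem_left _ _ hbb) ?_)
      refine Ideal.sum_mem _ fun i _ => Ideal.mul_mem_left _ _ ?_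
      exact (Ideal.add_mem_iff_left _ (Ideal.mul_mem_right _ _ h)).mp (hs i)
    · exact key ⟨hbb, h⟩


lemma Rq_of_zero_one {D : Type*} [CommRing D] {n : ℕ} (v : Fin (n+1) → D) (h : v 0 = 1) :
    Rq v (Pi.single 0 1) := by
  convert Rq.pour 0 (Finset.univ.erase 0) (by simp) (fun i => - v i) v using 1
  ext i
  by_cases hi : i = 0
  · subst hi; simp [h]
  · simp [hi, h]

lemma Rq_of_tail_um {D : Type*} [CommRing D] {n : ℕ} (v : Fin (n+1) → D)
    (h : Um (fun i : Fin n => v i.succ)) : Rq v (Pi.single 0 1) := by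
  obtain ⟨c, hc⟩ := h
  refine (Rq.multi 0 (Finset.univ.erase 0) (by simp)
    (fun i => (1 - v 0) * (Fin.cons 0 c : Fin (n+1) → D) i) v).trans (Rq_of_zero_one _ ?_)
  have : ∑ j ∈ Finset.univ.erase 0, (1 - v 0) * (Fin.cons 0 c : Fin (n+1) → D) j * v j
      = 1 - v 0 := by
    rw [Finset.sum_erase _ (by simp), Fin.sum_univ_succ]
    simp only [Fin.cons_zero, Fin.cons_succ, mul_assoc, ← Finset.mul_sum, hc]
    ring
  rw [this]; simp

theorem Rq_of_dim {C : Type*} [CommRing C] {n : ℕ} (hC : ringKrullDim C < (n : ℕ))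
    (v : Fin (n+1) → C) (hv : Um v) : Rq v (Pi.single 0 1) := by
  obtain ⟨c, hc⟩ := hv
  rw [Fin.sum_univ_succ] at hc
  obtain ⟨x, hx⟩ := SR n C hC (v 0) (fun i => v i.succ) ⟨_, _, hc⟩
  refine (Rq.pour 0 (Finset.univ.erase 0) (by simp) (Fin.cons 0 x : Fin (n+1) → C) v).trans
    (Rq_of_tail_um _ ?_)
  convert hx using 2 with i
  simp; ring

end dim
end YC

namespace YC
set_option linter.unusedSectionVars false
set_option linter.unusedSimpArgs false
open Matrix
section TL
variable {n : Type*} [Fintype n] [DecidableEq n] {D : Type*} [CommRing D]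
  (G : Submonoid (Matrix n n D))

lemma vmv_mul (a b c d : n → D) :
    vecMulVec a b * vecMulVec c d = (b ⬝ᵥ c) • vecMulVec a d := by
  rw [vecMulVec_mul_vecMulVec]
  ext i j
  simp [vecMulVec_apply]
  ring

lemma vmv_single (i j : n) (x y : D) :
    vecMulVec (Pi.single i x) (Pi.single j y) = Matrix.single i j (x * y) := by
  ext a b
  by_cases h1 : a = i
  · by_cases h2 : b = j
    · subst h1 h2; simp [vecMulVec_apply]
    · simp [vecMulVec_apply, h2, Matrix.single_apply, Ne.symm h2]
  · simp [vecMulVec_apply, h1, Matrix.single_apply, Ne.symm h1]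

lemma mem_add_left {φ a b : n → D} (hb : φ ⬝ᵥ b = 0) (h1 : 1 + vecMulVec a φ ∈ G)
    (h2 : 1 + vecMulVec b φ ∈ G) : 1 + vecMulVec (a + b) φ ∈ G := by
  convert mul_mem h1 h2 using 1
  rw [mul_add, add_mul, add_mul, vmv_mul, hb, add_vecMulVec]
  simp [add_assoc]

lemma mem_add_right {p a b : n → D} (hb : a ⬝ᵥ p = 0) (h1 : 1 + vecMulVec p a ∈ G)
    (h2 : 1 + vecMulVec p b ∈ G) : 1 + vecMulVec p (a + b) ∈ G := by
  convert mul_mem h1 h2 using 1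
  rw [mul_add, add_mul, add_mul, vmv_mul, hb, vecMulVec_add]
  simp [add_assoc]

lemma mem_sum_left {ι : Type*} (s : Finset ι) {φ : n → D} (a : ι → n → D)
    (hb : ∀ i ∈ s, φ ⬝ᵥ a i = 0) (h1 : ∀ i ∈ s, 1 + vecMulVec (a i) φ ∈ G) :
    1 + vecMulVec (∑ i ∈ s, a i) φ ∈ G := by
  classical
  induction s using Finset.induction_on with
  | empty => simp [one_mem]
  | insert x s hx ih =>
    rw [Finset.sum_insert hx, add_comm (a x)]
    exact mem_add_left G (hb x (by simp)) (ih (fun i hi => hb i (by simp [hi]))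
      (fun i hi => h1 i (by simp [hi]))) (h1 x (by simp))

lemma mem_sum_right {ι : Type*} (s : Finset ι) {p : n → D} (a : ι → n → D)
    (hb : ∀ i ∈ s, a i ⬝ᵥ p = 0) (h1 : ∀ i ∈ s, 1 + vecMulVec p (a i) ∈ G) :
    1 + vecMulVec p (∑ i ∈ s, a i) ∈ G := by
  classical
  induction s using Finset.induction_on with
  | empty => simp [one_mem]
  | insert x s hx ih =>
    rw [Finset.sum_insert hx]
    exact mem_add_right G (hb x (by simp)) (h1 x (by simp)) (ih (fun i hi => hb i (by simp [hi]))
      (fun i hi => h1 i (by simp [hi])))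


lemma mem_disj (T : D)
    (hG : ∀ (i j : n) (c : D), i ≠ j → transvection i j (T * c) ∈ G) (a b : n → D) (h : ∀ i, a i * b i = 0) : 1 + vecMulVec (T • a) b ∈ G := by
  have ha : T • a = ∑ i, Pi.single i (T * a i) := by
    ext j; simp [Finset.sum_apply, Pi.single_apply]
  have hb : b = ∑ i, Pi.single i (b i) := by
    ext j; simp [Finset.sum_apply, Pi.single_apply]
  rw [ha]
  refine mem_sum_left G _ _ (fun i _ => ?_) (fun i _ => ?_)
  · simp; linear_combination T * h i
  · rw [hb]
    refine mem_sum_right G _ _ (fun j _ => ?_) (fun j _ => ?_)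
    · by_cases hij : i = j
      · subst hij; simp; linear_combination T * h i
      · simp [Pi.single_apply, hij]
    · by_cases hij : i = j
      · subst hij
        have e : vecMulVec (Pi.single i (T * a i)) (Pi.single i (b i)) = 0 := by
          rw [vmv_single, mul_assoc, h i]; simp
        rw [e, add_zero]; exact one_mem G
      · rw [vmv_single, mul_assoc]
        exact hG i j (a i * b j) hij

lemma mem_comm (T : D)
    (hG : ∀ (i j : n) (c : D), i ≠ j → transvection i j (T * c) ∈ G) (a b : n → D) (k : n) (ha : a k = 0) (hb : b k = 0) (hab : b ⬝ᵥ a = 0) :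
    1 + vecMulVec (T ^ 2 • a) b ∈ G := by
  have h1 := mem_disj G T hG a (Pi.single k 1) (fun i => by
    by_cases h : i = k
    · subst h; simp [ha]
    · simp [h])
  have h2 := mem_disj G T hG (Pi.single k 1) b (fun i => by
    by_cases h : i = k
    · subst h; simp [hb]
    · simp [h])
  have h3 := mem_disj G T hG (-a) (Pi.single k 1) (fun i => by
    by_cases h : i = k
    · subst h; simp [ha]
    · simp [h])
  have h4 := mem_disj G T hG (-Pi.single k 1) b (fun i => by
    by_cases h : i = k
    · subst h; simp [hb]
    · simp [h])
  have h5 := mul_mem (mul_mem h1 h2) (mul_mem h3 h4)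
  convert h5 using 1
  set N := vecMulVec (T • a) (Pi.single k (1 : D)) with hN
  set M := vecMulVec (T • (Pi.single k (1:D))) b with hM
  have e3 : vecMulVec (T • -a) (Pi.single k (1 : D)) = -N := by
    rw [smul_neg, neg_vecMulVec]
  have e4 : vecMulVec (T • -(Pi.single k (1:D))) b = -M := by
    rw [smul_neg, neg_vecMulVec]
  rw [e3, e4]
  have hNN : N * N = 0 := by
    rw [hN, vmv_mul]; simp [ha]
  have hMM : M * M = 0 := by
    rw [hM, vmv_mul]; simp [hb]
  have hMN : M * N = 0 := by
    rw [hM, hN, vmv_mul]; simp [hab]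
  have hNM : N * M = vecMulVec (T ^ 2 • a) b := by
    rw [hM, hN, vmv_mul]
    ext i j
    simp [vecMulVec_apply]; ring
  rw [← hNM]
  have hNMM : N * (M * M) = 0 := by rw [hMM, mul_zero]
  have hNMN : N * (M * N) = 0 := by rw [hMN, mul_zero]
  have hMNM : M * (N * M) = 0 := by rw [← mul_assoc, hMN, zero_mul]
  have hNNM : N * (N * M) = 0 := by rw [← mul_assoc, hNN, zero_mul]
  simp only [mul_add, add_mul, mul_neg, neg_mul, mul_assoc, one_mul, mul_one, hNN, hMM, hMN,
    hNMM, hNMN, hMNM, hNNM, mul_zero]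
  abel

lemma mem_pair (T : D)
    (hG : ∀ (i j : n) (c : D), i ≠ j → transvection i j (T * c) ∈ G) (h3 : ∀ i j : n, ∃ k, k ≠ i ∧ k ≠ j) (φ : n → D) (i j : n) (c : D) :
    1 + vecMulVec (T ^ 2 • c • (Pi.single j (φ i) - Pi.single i (φ j))) φ ∈ G := by
  by_cases hij : i = j
  · subst hij; simp [one_mem]
  obtain ⟨k, hki, hkj⟩ := h3 i j
  set a : n → D := c • (Pi.single j (φ i) - Pi.single i (φ j)) with ha
  set b : n → D := Pi.single i (φ i) + Pi.single j (φ j) with hb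
  have hφ : φ = (φ - b) + b := by abel
  have hd : ∀ x, a x * (φ - b) x = 0 := by
    intro x
    by_cases h1 : x = i
    · subst h1; simp [ha, hb, hij]
    · by_cases h2 : x = j
      · subst h2; simp [ha, hb, Ne.symm hij]
      · simp [ha, hb, h1, h2]
  rw [hφ]
  refine mem_add_right G ?_ ?_ ?_
  · rw [dotProduct]
    refine Finset.sum_eq_zero fun x _ => ?_
    have := hd x
    simp only [Pi.smul_apply, smul_eq_mul]
    linear_combination T ^ 2 * this
  · have := mem_disj G T hG (T • a) (φ - b) (fun x => by
      simp only [Pi.smul_apply, smul_eq_mul]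
      linear_combination T * hd x)
    rwa [smul_smul, ← pow_two] at this
  · refine mem_comm G T hG a b k ?_ ?_ ?_
    · simp [ha, hki, hkj]
    · simp [hb, hki, hkj]
    · simp [ha, hb, hij, Ne.symm hij, Pi.single_apply, add_mul, mul_sub]; ring

theorem TL (T : D)
    (hG : ∀ (i j : n) (c : D), i ≠ j → transvection i j (T * c) ∈ G) (h3 : ∀ i j : n, ∃ k, k ≠ i ∧ k ≠ j) (φ p ψ : n → D) (s c : D)
    (h0 : φ ⬝ᵥ p = 0) (hs : ψ ⬝ᵥ φ = s) :
    1 + vecMulVec ((T ^ 2 * s * c) • p) φ ∈ G := by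
  have key : (T ^ 2 * s * c) • p = ∑ i, ∑ j, T ^ 2 • (c * ψ i * p j) •
      ((Pi.single j (φ i) - Pi.single i (φ j) : n → D)) := by
    ext x
    simp only [Finset.sum_apply, Pi.smul_apply, Pi.sub_apply, smul_eq_mul, mul_sub,
      Finset.sum_sub_distrib, Pi.single_apply, mul_ite, mul_zero]
    rw [← hs]
    have e1 : ∀ i, (∑ j, if x = j then T ^ 2 * (c * ψ i * p j * φ i) else 0) =
      T ^ 2 * (c * ψ i * p x * φ i) := by intro i; simp
    have e2 : (∑ i, ∑ j, if x = i then T ^ 2 * (c * ψ i * p j * φ j) else 0) =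
       T ^ 2 * (c * ψ x * (φ ⬝ᵥ p)) := by
      rw [Finset.sum_comm]
      simp only [Finset.sum_ite_eq, Finset.mem_univ, if_true, dotProduct, Finset.mul_sum]
      exact Finset.sum_congr rfl fun i _ => by ring
    rw [e2, h0, Finset.sum_congr rfl (fun i _ => e1 i)]
    simp only [dotProduct, Finset.mul_sum, Finset.sum_mul, mul_zero, sub_zero]
    exact Finset.sum_congr rfl fun i _ => by ring
  have horth : ∀ i j, φ ⬝ᵥ (T ^ 2 • (c * ψ i * p j) •
      ((Pi.single j (φ i) - Pi.single i (φ j) : n → D))) = 0 := by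
    intro i j; simp [dotProduct_smul, dotProduct_sub, mul_comm]
  rw [key]
  refine mem_sum_left G _ _ (fun i _ => ?_) (fun i _ => ?_)
  · rw [dotProduct_sum]
    exact Finset.sum_eq_zero fun j _ => horth i j
  · exact mem_sum_left G _ _ (fun j _ => horth i j) (fun j _ => mem_pair G T hG h3 φ i j _)

end TL
end YC

namespace YC
set_option linter.unusedSectionVars false
set_option linter.unusedSimpArgs false
open Matrix
section dil
variable {n : Type*} [Fintype n] [DecidableEq n] {D D' : Type*} [CommRing D] [CommRing D']
  (φ : D →+* D') (S : Submonoid D)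

/-- weak localization hypothesis -/
structure Loc : Prop where
  h1 : ∀ x : D', ∃ s ∈ S, ∃ y, φ s * x = φ y
  h2 : ∀ x : D, φ x = 0 → ∃ s ∈ S, s * x = 0

variable {φ S}

lemma Loc.fam (L : Loc φ S) {ι : Type*} (t : Finset ι) (x : ι → D') :
    ∃ s ∈ S, ∃ y : ι → D, ∀ i ∈ t, φ s * x i = φ (y i) := by
  classical
  induction t using Finset.induction_on with
  | empty => exact ⟨1, one_mem _, fun _ => 0, by simp⟩
  | insert a t ha ih =>
    obtain ⟨s, hs, y, hy⟩ := ih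
    obtain ⟨s', hs', y', hy'⟩ := L.h1 (x a)
    refine ⟨s * s', mul_mem hs hs', fun i => if i = a then s * y' else s' * y i, ?_⟩
    intro i hi
    by_cases h : i = a
    · subst h; simp only [if_true, map_mul]; rw [← hy']; ring
    · have : i ∈ t := by simpa [h] using hi
      simp only [h, if_false, map_mul]; rw [← hy i this]; ring

lemma Loc.poly (L : Loc φ S) (k : D'[X]) : ∃ s ∈ S, ∃ y : D[X], C (φ s) * k = y.map φ := by
  induction k using Polynomial.induction_on' with
  | add p q hp hq =>
    obtain ⟨s, hs, y, hy⟩ := hp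
    obtain ⟨s', hs', y', hy'⟩ := hq
    refine ⟨s * s', mul_mem hs hs', C s' * y + C s * y', ?_⟩
    simp only [Polynomial.map_add, Polynomial.map_mul, map_C, map_mul, ← hy, ← hy']
    ring
  | monomial m a =>
    obtain ⟨s, hs, y, hy⟩ := L.h1 a
    exact ⟨s, hs, monomial m y, by simp [C_mul_monomial, hy]⟩

/-- the polynomial extension of a weak localization -/
lemma Loc.polyLoc (L : Loc φ S) : Loc (mapRingHom φ) (S.map (C : D →+* D[X])) where
  h1 k := by
    obtain ⟨s, hs, y, hy⟩ := L.poly k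
    exact ⟨C s, ⟨s, hs, rfl⟩, y, by simpa using hy⟩
  h2 x hx := by
    have hx0 : ∀ i, φ (x.coeff i) = 0 := fun i => by
      have := congrArg (fun q => coeff q i) hx
      simpa using this
    have : ∀ t : Finset ℕ, ∃ s ∈ S, ∀ i ∈ t, s * x.coeff i = 0 := by
      intro t
      induction t using Finset.induction_on with
      | empty => exact ⟨1, one_mem _, by simp⟩
      | insert a t ha ih =>
        obtain ⟨s, hs, h⟩ := ih
        obtain ⟨s', hs', h'⟩ := L.h2 _ (hx0 a)
        refine ⟨s * s', mul_mem hs hs', ?_⟩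
        intro i hi
        rcases Finset.mem_insert.mp hi with rfl | hi
        · rw [mul_assoc, h', mul_zero]
        · rw [mul_comm s, mul_assoc, h i hi, mul_zero]
    obtain ⟨s, hs, h⟩ := this x.support
    refine ⟨C s, ⟨s, hs, rfl⟩, ?_⟩
    ext i
    rw [coeff_C_mul, coeff_zero]
    by_cases hi : i ∈ x.support
    · exact h i hi
    · rw [notMem_support_iff.mp hi, mul_zero]

/-- substitution T -> sT -/
noncomputable def sc {D : Type*} [CommRing D] (s : D) : D[X] →+* D[X] := compRingHom (C s * X)
noncomputable def cz {D : Type*} [CommRing D] : D[X] →+* D[X] := C.comp (evalRingHom 0)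

lemma conj_trans {E : Type*} [CommRing E] (γ δ : Matrix n n E) (h : γ * δ = 1)
    (i j : n) (x : E) :
    γ * transvection i j x = (1 + vecMulVec (x • γ.col i) (δ.row j)) * γ := by
  have h' : δ * γ = 1 := mul_eq_one_comm.mp h
  rw [transvection, mul_add, add_mul, one_mul, mul_one]
  congr 1
  rw [vecMulVec_mul]
  have : δ.row j ᵥ* γ = Pi.single j 1 := by
    ext k
    have := congrFun (congrFun h' j) k
    rw [Matrix.mul_apply] at this
    rw [Matrix.vecMul, dotProduct]
    simp only [Matrix.row]
    rw [this, Matrix.one_apply, Pi.single_apply]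
    simp [eq_comm]
  rw [this]
  ext a b
  rw [vecMulVec_apply, Matrix.mul_apply]
  by_cases hb : b = j
  · subst hb
    simp [Matrix.single_apply, mul_comm]
  · simp [Matrix.single_apply, Ne.symm hb, hb]

lemma dil_bracket (L : Loc φ S) (h3 : ∀ i j : n, ∃ k, k ≠ i ∧ k ≠ j) (γ δ : Matrix n n D')
    (h : γ * δ = 1) (i j : n) (hij : i ≠ j) (k : D'[X]) :
    ∃ s0 ∈ S, ∀ u : D, ∃ β ∈ El n D[X], (evalRingHom 0).mapMatrix β = 1 ∧
      (mapRingHom φ).mapMatrix β * (C : D' →+* D'[X]).mapMatrix γ =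
      (C : D' →+* D'[X]).mapMatrix γ *
        transvection i j (C (φ (s0 * u)) * X * sc (φ (s0 * u)) k) := by
  have h' : δ * γ = 1 := mul_eq_one_comm.mp h
  obtain ⟨sp, hsp, p, hp⟩ := L.fam Finset.univ (γ.col i)
  obtain ⟨sq, hsq, q, hq⟩ := L.fam Finset.univ (δ.row j)
  obtain ⟨sr, hsr, r, hr⟩ := L.fam Finset.univ (γ.col j)
  obtain ⟨s4, hs4, k4, hk4⟩ := L.poly k
  have hz : φ (q ⬝ᵥ p) = 0 := by
    have := congrFun (congrFun h' j) i
    rw [Matrix.mul_apply, Matrix.one_apply_ne hij.symm] at this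
    rw [dotProduct, map_sum]
    calc ∑ x, φ (q x * p x) = ∑ x, φ sq * φ sp * (δ j x * γ x i) := by
          refine Finset.sum_congr rfl fun x _ => ?_
          rw [map_mul, ← hp x (Finset.mem_univ _), ← hq x (Finset.mem_univ _)]
          simp only [Matrix.col_apply, Matrix.row]; ring
      _ = 0 := by rw [← Finset.mul_sum, this, mul_zero]
  have hone : φ (r ⬝ᵥ q) = φ (sr * sq) := by
    have := congrFun (congrFun h' j) j
    rw [Matrix.mul_apply, Matrix.one_apply_eq] at this
    rw [dotProduct, map_sum]
    calc ∑ x, φ (r x * q x) = ∑ x, φ sq * φ sr * (δ j x * γ x j) := by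
          refine Finset.sum_congr rfl fun x _ => ?_
          rw [map_mul, ← hr x (Finset.mem_univ _), ← hq x (Finset.mem_univ _)]
          simp only [Matrix.col_apply, Matrix.row]; ring
      _ = _ := by rw [← Finset.mul_sum, this, mul_one, map_mul, mul_comm]
  obtain ⟨s2, hs2, hs2'⟩ := L.h2 _ hz
  refine ⟨sr * sq * (s2 * sp) * sq * s4, ?_, ?_⟩
  · exact mul_mem (mul_mem (mul_mem (mul_mem hsr hsq) (mul_mem hs2 hsp)) hsq) hs4
  intro u
  set s := sr * sq * (s2 * sp) * sq * s4 * u with hsdef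
  have hT := TL (El n D[X]) 1 (fun i j c hij => trans_mem hij _) h3
    (fun x => C (q x)) (fun x => C (s2 * p x)) (fun x => C (r x)) (C (r ⬝ᵥ q))
    (C u * X * sc s k4)
    (by
      rw [dotProduct] at hs2' ⊢
      simp only [← map_mul, ← map_sum]
      rw [← map_zero C, ← hs2', Finset.mul_sum]
      congr 1
      exact Finset.sum_congr rfl fun x _ => by ring)
    (by
      rw [dotProduct, dotProduct]
      simp only [← map_mul, ← map_sum])
  rw [one_pow, one_mul] at hT
  refine ⟨_, hT, ?_, ?_⟩
  · ext a b
    simp [vecMulVec_apply, Matrix.one_apply]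
    split_ifs <;> simp
  · have hCinv : (C : D' →+* D'[X]).mapMatrix γ * (C : D' →+* D'[X]).mapMatrix δ = 1 := by
      rw [← map_mul, h, map_one]
    rw [conj_trans _ _ hCinv]
    congr 1
    rw [map_add, map_one]
    congr 1
    ext1 a b
    have hsck : (sc s k4).map φ = C (φ s4) * sc (φ s) k := by
      have : C (φ s4) * sc (φ s) k = sc (φ s) (C (φ s4) * k) := by
        rw [map_mul]; congr 1; simp [sc]
      rw [this, hk4]
      simp [sc, Polynomial.map_comp]
    have e1 := hp a (Finset.mem_univ _)
    have e2 := hq b (Finset.mem_univ _)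
    simp only [Matrix.col_apply, Matrix.row] at e1 e2
    simp only [RingHom.mapMatrix_apply, Matrix.map_apply, vecMulVec_apply, Pi.smul_apply,
      smul_eq_mul, Matrix.col_apply, Matrix.row, coe_mapRingHom, Polynomial.map_mul, hsck,
      Polynomial.map_C, Polynomial.map_X, hone, map_mul]
    rw [← e1, ← e2, hsdef]
    simp only [map_mul]
    ring

theorem dilation (L : Loc φ S) (h3 : ∀ i j : n, ∃ k, k ≠ i ∧ k ≠ j) {σ : Matrix n n D'[X]}
    (hσ : σ ∈ El n D'[X]) :
    ∃ s0 ∈ S, ∀ u : D, ∃ τ ∈ El n D[X], (evalRingHom 0).mapMatrix τ = 1 ∧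
      (mapRingHom φ).mapMatrix τ * (cz.mapMatrix σ) = (sc (φ (s0 * u))).mapMatrix σ := by
  induction hσ using Submonoid.closure_induction_right with
  | one => exact ⟨1, one_mem _, fun u => ⟨1, one_mem _, by simp, by simp⟩⟩
  | mul_right σ' hσ' y hy ih =>
    obtain ⟨i, j, c, hij, rfl⟩ := hy
    obtain ⟨s1, hs1, h1⟩ := ih
    let γ : Matrix n n D' := (evalRingHom 0).mapMatrix σ'
    have hγ : γ ∈ El n D' := El_map _ hσ'
    obtain ⟨δ, _, hγδ, _⟩ := El_inv hγ
    obtain ⟨s2, hs2, h2⟩ := dil_bracket L h3 γ δ hγδ i j hij c.divX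
    refine ⟨s1 * s2, mul_mem hs1 hs2, fun u => ?_⟩
    obtain ⟨τ, hτ, hτ0, hτ1⟩ := h1 (s2 * u)
    obtain ⟨β, hβ, hβ0, hβ1⟩ := h2 (s1 * u)
    refine ⟨τ * β, mul_mem hτ hβ, by rw [map_mul, hτ0, hβ0, one_mul], ?_⟩
    have es1 : s1 * (s2 * u) = s1 * s2 * u := by ring
    have es2 : s2 * (s1 * u) = s1 * s2 * u := by ring
    rw [es1] at hτ1
    rw [es2] at hβ1
    set s := s1 * s2 * u
    have hγ' : (C : D' →+* D'[X]).mapMatrix γ = cz.mapMatrix σ' := by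
      ext a b; simp [γ, cz]
    rw [hγ'] at hβ1
    rw [map_mul, map_mul, map_mul, map_trans, map_trans, ← hτ1]
    have ec : sc (φ s) c = C (φ s) * X * sc (φ s) c.divX + cz c := by
      conv_lhs => rw [← divX_mul_X_add c]
      rw [map_add, map_mul]
      simp [sc, cz, coeff_zero_eq_eval_zero]
      ring
    rw [ec, ← transvection_mul_transvection_same _ _ hij]
    simp only [mul_assoc] at hβ1 ⊢
    rw [← mul_assoc (cz.mapMatrix σ'), ← hβ1]
    simp only [mul_assoc]
end dil
end YC

namespace YC
set_option linter.unusedSectionVars false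
set_option linter.unusedSimpArgs false
open Matrix
section LG
variable {n : Type*} [Fintype n] [DecidableEq n]

noncomputable def sh (K : Type*) [CommRing K] : K[X] →+* K[X][X] :=
  eval₂RingHom (C.comp C) (C X + X)

lemma sh_nat {K K' : Type*} [CommRing K] [CommRing K'] (ψ : K →+* K') :
    (mapRingHom (mapRingHom ψ)).comp (sh K) = (sh K').comp (mapRingHom ψ) := by
  apply Polynomial.ringHom_ext
  · intro a; simp [sh]
  · simp [sh]

lemma sh_zero (K : Type*) [CommRing K] : (evalRingHom 0).comp (sh K) = RingHom.id _ := by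
  apply Polynomial.ringHom_ext
  · intro a; simp [sh]
  · simp [sh]

/-- composition of a row of polynomials with `y`. -/
noncomputable def cp {R : Type*} [CommRing R] (f : n → R[X]) (y : R[X]) : n → R[X] :=
  fun i => (f i).comp y

def Qid {R : Type*} [CommRing R] (f : n → R[X]) : Ideal R where
  carrier := {s | ∀ y z : R[X], Rq (cp f y) (cp f (y + C s * z))}
  add_mem' := by
    intro a b ha hb y z
    have := (ha y z).trans (hb (y + C a * z) z)
    rwa [add_assoc, ← add_mul, ← map_add] at this
  zero_mem' := by intro y z; simpa using Rq.refl _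
  smul_mem' := by
    intro c s hs y z
    have := hs y (C c * z)
    rwa [← mul_assoc, ← map_mul, mul_comm s c] at this

lemma Qid_local {R : Type*} [CommRing R] (h3 : ∀ i j : n, ∃ k, k ≠ i ∧ k ≠ j)
    (f : n → R[X]) {K : Type*} [CommRing K] (ψ : R →+* K) (S : Submonoid R)
    (L : Loc ψ S) (e : n → K)
    (h : Rq (fun i => (f i).map ψ) (fun i => C (e i))) : ∃ s ∈ S, s ∈ Qid f := by
  obtain ⟨ε, hε, hεf⟩ := h
  have L1 := L.polyLoc
  have L2 := L1.polyLoc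
  obtain ⟨δ, hδ, hδ1⟩ := El_inv (El_map (sh K) hε)
  set θ : Matrix n n K[X][X] := δ * (C : K[X] →+* K[X][X]).mapMatrix ε with hθ
  have hθE : θ ∈ El n K[X][X] := mul_mem hδ (El_map _ hε)
  -- θ at 0 is one
  have hδ0 : (evalRingHom 0).mapMatrix δ * ε = 1 := by
    have := congrArg (evalRingHom (0 : K[X])).mapMatrix hδ1.2
    rw [map_mul, map_one] at this
    have e : (evalRingHom (0 : K[X])).mapMatrix ((sh K).mapMatrix ε) = ε := by
      ext1 a b
      exact RingHom.congr_fun (sh_zero K) (ε a b)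
    rwa [e] at this
  have hθ0 : cz.mapMatrix θ = 1 := by
    have h1 : (evalRingHom (0 : K[X])).mapMatrix θ = 1 := by
      rw [hθ, map_mul]
      have e : (evalRingHom (0 : K[X])).mapMatrix ((C : K[X] →+* K[X][X]).mapMatrix ε) = ε := by
        ext1 a b; simp
      rw [e, hδ0]
    have : (cz : K[X][X] →+* K[X][X]).mapMatrix θ =
        (C : K[X] →+* K[X][X]).mapMatrix ((evalRingHom (0 : K[X])).mapMatrix θ) := by
      ext1 a b; simp [cz]
    rw [this, h1, map_one]
  let f' : n → K[X] := fun i => (f i).map ψ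
  have hθf : θ.mulVec (C ∘ f') = sh K ∘ f' := by
    rw [hθ, ← mulVec_mulVec, map_mulVec', hεf]
    have : (C : K[X] →+* K[X][X]) ∘ (fun i => C (e i)) = sh K ∘ (fun i => C (e i)) := by
      ext1 i; simp [sh]
    rw [this, ← hεf, ← map_mulVec', mulVec_mulVec, hδ1.2, one_mulVec]
  obtain ⟨_, ⟨s0, hs0, rfl⟩, hdil⟩ := dilation L1 h3 hθE
  obtain ⟨τ, hτ, hτ0, hτ1⟩ := hdil 1
  rw [hθ0, mul_one, mul_one] at hτ1
  -- difference
  let d : n → R[X][X] := fun i => τ.mulVec (C ∘ f) i - sc (C s0) (sh R (f i))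
  have hd0 : ∀ i, (d i).coeff 0 = 0 := by
    intro i
    have e1 : evalRingHom 0 (τ.mulVec (C ∘ f) i) = f i := by
      have := congrFun (map_mulVec' (evalRingHom (0 : R[X])) τ (C ∘ f)) i
      rw [Function.comp_apply] at this
      rw [← this, hτ0, one_mulVec]; simp
    have e2 : evalRingHom 0 (sc (C s0) (sh R (f i))) = f i := by
      have : (evalRingHom (0 : R[X])).comp ((sc (C s0)).comp (sh R)) = RingHom.id _ := by
        apply Polynomial.ringHom_ext
        · intro a; simp [sh, sc]
        · simp [sh, sc]
      exact RingHom.congr_fun this (f i)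
    rw [coeff_zero_eq_eval_zero, ← coe_evalRingHom, map_sub, e1, e2, sub_self]
  have hdφ : ∀ i, mapRingHom (mapRingHom ψ) (d i) = 0 := by
    intro i
    rw [map_sub, sub_eq_zero]
    have e1 : mapRingHom (mapRingHom ψ) (τ.mulVec (C ∘ f) i) =
        ((sc (mapRingHom ψ (C s0))).mapMatrix θ).mulVec (C ∘ f') i := by
      have := congrFun (map_mulVec' (mapRingHom (mapRingHom ψ)) τ (C ∘ f)) i
      rw [Function.comp_apply] at this
      rw [← this, hτ1]
      congr 2
      ext1 k; simp [f']
    have e2 : (C : K[X] →+* K[X][X]) ∘ f' = (sc (mapRingHom ψ (C s0))) ∘ (C ∘ f') := by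
      ext1 k; simp [sc]
    rw [e1, e2, map_mulVec', hθf]
    have e3 : (sc (mapRingHom ψ (C s0))).comp ((sh K).comp (mapRingHom ψ)) =
      (mapRingHom (mapRingHom ψ)).comp ((sc (C s0)).comp (sh R)) := by
      apply Polynomial.ringHom_ext
      · intro a; simp [sh, sc]
      · simp [sh, sc]
    exact RingHom.congr_fun e3 (f i)
  have hdX : ∀ i, mapRingHom (mapRingHom ψ) (d i).divX = 0 := by
    intro i
    ext1 m
    have := congrArg (fun q => coeff q (m + 1)) (hdφ i)
    simpa [coeff_divX] using this
  have := fun i => L2.h2 _ (hdX i)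
  choose a ha ha' using this
  have hb : ∀ i, ∃ b ∈ S, a i = C (C b) := by
    intro i
    obtain ⟨_, ⟨b, hb, rfl⟩, h⟩ := ha i
    exact ⟨b, hb, h.symm⟩
  choose b hbS hb using hb
  refine ⟨s0 * ∏ i, b i, mul_mem hs0 (Submonoid.prod_mem _ fun i _ => hbS i), ?_⟩
  intro y z
  set s1 := ∏ i, b i with hs1
  have hs1d : ∀ i, C (C s1) * (d i).divX = 0 := by
    intro i
    obtain ⟨c, hc⟩ := Finset.dvd_prod_of_mem b (Finset.mem_univ i)
    rw [hs1, hc, map_mul, map_mul, mul_comm (C (C (b i))), mul_assoc, ← hb, ha', mul_zero]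
  let ev : R[X][X] →+* R[X] := eval₂RingHom (compRingHom y) (C s1 * z)
  have hevd : ∀ i, ev (d i) = 0 := by
    intro i
    have e0 : d i = (d i).divX * X := by
      conv_lhs => rw [← divX_mul_X_add (d i), hd0]
      simp
    have e1 : ev (C (C s1) * (d i).divX) = 0 := by rw [hs1d, map_zero]
    rw [map_mul] at e1
    have e2 : ev (C (C s1)) = C s1 := by simp [ev]
    rw [e2] at e1
    rw [e0, map_mul]
    have e3 : ev X = C s1 * z := by simp [ev]
    rw [e3]
    linear_combination z * e1
  refine ⟨ev.mapMatrix τ, El_map _ hτ, ?_⟩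
  have e1 : cp f y = ev ∘ (C ∘ f) := by
    ext1 i; simp [ev, cp]
  rw [e1, map_mulVec']
  ext1 i
  have e2 := hevd i
  rw [map_sub, sub_eq_zero] at e2
  rw [Function.comp_apply, e2]
  have e3 : (ev.comp ((sc (C s0)).comp (sh R))) = compRingHom (y + C (s0 * s1) * z) := by
    apply Polynomial.ringHom_ext
    · intro a; simp [sh, sc, ev]
    · simp [sh, sc, ev, mul_assoc]
  exact RingHom.congr_fun e3 (f i)

theorem LG {R : Type*} [CommRing R] (h3 : ∀ i j : n, ∃ k, k ≠ i ∧ k ≠ j)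
    (f : n → R[X]) (e : n → R)
    (h : ∀ (m : Ideal R) [m.IsMaximal], Rq
      (fun i => (f i).map (algebraMap R (Localization.AtPrime m)))
      (fun i => C (algebraMap R (Localization.AtPrime m) (e i)))) :
    Rq f (fun i => C ((f i).eval 0)) := by
  have hQ : Qid f = ⊤ := by
    by_contra hne
    obtain ⟨m, hm, hle⟩ := Ideal.exists_le_maximal _ hne
    obtain ⟨s, hs, hs'⟩ := Qid_local h3 f (algebraMap R (Localization.AtPrime m)) m.primeCompl
      ⟨fun x => by
        obtain ⟨⟨a, s⟩, h⟩ := IsLocalization.surj m.primeCompl x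
        exact ⟨s, s.2, a, by rw [mul_comm]; exact h⟩,
       fun x hx => by
        obtain ⟨t, ht⟩ := (IsLocalization.map_eq_zero_iff m.primeCompl _ _).mp hx
        exact ⟨t, t.2, ht⟩⟩ _ (h m)
    exact hs (hle hs')
  have h1 : (1 : R) ∈ Qid f := by rw [hQ]; trivial
  have := h1 X (-X)
  simp only [map_one, one_mul, add_neg_cancel] at this
  convert this using 1
  · ext1 i; simp [cp]
  · ext1 i; simp [cp, comp_zero]
end LG
end YC

namespace YC
set_option linter.unusedSectionVars false
set_option linter.unusedSimpArgs false

lemma Rq_of_unit {D : Type*} [CommRing D] {n : ℕ} (v : Fin (n+2) → D) (i : Fin (n+2))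
    (h : IsUnit (v i)) : Rq v (Pi.single 0 1) := by
  have key : ∀ (v : Fin (n+2) → D) (i : Fin (n+2)), i ≠ 0 → IsUnit (v i) →
      Rq v (Pi.single 0 1) := by
    intro v i hi h
    obtain ⟨u, hu⟩ := h
    refine (Rq.step (Ne.symm hi) ((1 - v 0) * (↑u⁻¹ : D)) v).trans (Rq_of_zero_one _ ?_)
    rw [← hu, mul_assoc]; simp
  by_cases hi : i = 0
  · subst hi
    obtain ⟨u, hu⟩ := h
    have h01 : (1 : Fin (n+2)) ≠ 0 := by simp
    refine (Rq.step h01 ((1 - v 1) * (↑u⁻¹ : D)) v).trans (key _ 1 h01 ?_)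
    rw [← hu, mul_assoc]; simp
  · exact key v i hi h

section local_
variable {R : Type*} [CommRing R] [IsLocalRing R]

lemma suslin_aux (m : ℕ) (f0 : R[X]) (h0 : f0.natDegree ≤ m + 1) (u0 : IsUnit (f0.coeff (m+1)))
    (N : ℕ) : ∀ (f1 : R[X]) (t : ℕ), t + N = m → f1.natDegree ≤ m → IsUnit (f1.coeff t) →
    ∃ p q : R[X], (p * f0 + q * f1).natDegree ≤ m ∧ IsUnit ((p * f0 + q * f1).coeff m) := by
  obtain ⟨u, hu⟩ := u0
  induction N with
  | zero =>
    intro f1 t ht h1 hu1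
    have : t = m := by omega
    subst this
    exact ⟨0, 1, by simpa using h1, by simpa using hu1⟩
  | succ N ih =>
    intro f1 t ht h1 hu1
    by_cases hm : IsUnit (f1.coeff m)
    · exact ⟨0, 1, by simpa using h1, by simpa using hm⟩
    set b : R := f1.coeff m * (↑u⁻¹ : R) with hb
    have hbn : ¬ IsUnit b := fun h => hm (isUnit_of_mul_isUnit_left h)
    obtain ⟨p, q, hp, hq⟩ := ih (X * f1 - C b * f0) (t + 1) (by omega) (by
      rw [natDegree_le_iff_coeff_eq_zero]
      intro k hk
      obtain ⟨k, rfl⟩ : ∃ k', k = k' + 1 := ⟨k - 1, by omega⟩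
      rw [coeff_sub, coeff_X_mul, coeff_C_mul]
      rcases Nat.lt_or_ge m k with h | h
      · rw [coeff_eq_zero_of_natDegree_lt (by omega : f1.natDegree < k),
          coeff_eq_zero_of_natDegree_lt (by omega : f0.natDegree < k + 1)]
        simp
      · have : k = m := by omega
        subst this
        rw [← hu, hb, mul_assoc]; simp) (by
      rw [coeff_sub, coeff_X_mul, coeff_C_mul]
      by_contra hcon
      have h2 : ¬ IsUnit (b * f0.coeff (t+1)) := fun h => hbn (isUnit_of_mul_isUnit_left h)
      have := IsLocalRing.nonunits_add hcon h2
      rw [sub_add_cancel] at this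
      exact this hu1)
    refine ⟨p - q * C b, q * X, ?_, ?_⟩
    · convert hp using 2; ring
    · convert hq using 2; ring

lemma isUnit_map_of_coeff {f : R[X]} : (∀ k, ¬ IsUnit (f.coeff k)) →
    f.map (IsLocalRing.residue R) = 0 := by
  intro h
  ext k
  rw [coeff_map, coeff_zero, IsLocalRing.residue_eq_zero_iff]
  exact h k

theorem horrocks {n : ℕ} (m : ℕ) : ∀ (f : Fin (n+3) → R[X]) (i : Fin (n+3)), Um f →
    (f i).natDegree ≤ m → IsUnit ((f i).coeff m) → Rq f (Pi.single 0 1) := by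
  induction m with
  | zero =>
    intro f i hf hd hu
    refine Rq_of_unit f i ?_
    rw [eq_C_of_natDegree_le_zero hd]
    exact hu.map C
  | succ m ih =>
    intro f i hf hd hu
    obtain ⟨u, hu⟩ := hu
    set g : R[X] := C (↑u⁻¹ : R) * f i with hg
    have hgm : g.Monic := by
      refine monic_of_natDegree_le_of_coeff_eq_one (m+1) ?_ ?_
      · exact (natDegree_C_mul_le _ _).trans hd
      · rw [hg, coeff_C_mul, ← hu]; simp
    have hgd : g.natDegree = m + 1 := by
      refine le_antisymm ((natDegree_C_mul_le _ _).trans hd) (le_natDegree_of_ne_zero ?_)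
      rw [hg, coeff_C_mul, ← hu]; simp
    have hr := Rq.pour i (Finset.univ.erase i) (by simp)
      (fun j => - (f j /ₘ g) * C (↑u⁻¹ : R)) f
    set f' := (fun j => if j ∈ Finset.univ.erase i then
      f j + (- (f j /ₘ g) * C (↑u⁻¹ : R)) * f i else f j) with hf'
    refine hr.trans ?_
    have hUm := hf.rq hr
    have hi : f' i = f i := by simp [hf']
    have hj : ∀ j ≠ i, (f' j).natDegree ≤ m := by
      intro j hj
      have : f' j = f j %ₘ g := by
        simp only [hf', Finset.mem_erase, hj, ne_eq, not_false_eq_true, Finset.mem_univ, and_self,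
          if_true]
        rw [modByMonic_eq_sub_mul_div, hg]; ring
      rw [this]
      have := natDegree_modByMonic_lt (f j) hgm (by
        intro h; rw [h] at hgd; simp at hgd)
      omega
    clear_value f'
    rw [← hi] at hd hu
    clear hr
    -- find a unit coefficient
    obtain ⟨j, hji, t, ht⟩ : ∃ j ≠ i, ∃ t, IsUnit ((f' j).coeff t) := by
      by_contra hcon
      push Not at hcon
      obtain ⟨c, hc⟩ := hUm
      have h1 := congrArg (Polynomial.map (IsLocalRing.residue R)) hc
      rw [Polynomial.map_sum, Finset.sum_eq_single i, Polynomial.map_mul, Polynomial.map_one] at h1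
      · have h2 : IsUnit ((f' i).map (IsLocalRing.residue R)) :=
          IsUnit.of_mul_eq_one_right _ h1
        have h3 := natDegree_eq_zero_of_isUnit h2
        have h4 : ((f' i).map (IsLocalRing.residue R)).coeff (m+1) ≠ 0 := by
          rw [coeff_map, ← hu]
          exact ((u.isUnit.map (IsLocalRing.residue R))).ne_zero
        exact h4 (coeff_eq_zero_of_natDegree_lt (by omega))
      · intro b _ hb
        rw [Polynomial.map_mul, isUnit_map_of_coeff (hcon b hb), mul_zero]
      · simp
    obtain ⟨k, hki, hkj⟩ : ∃ k : Fin (n+3), k ≠ i ∧ k ≠ j := by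
      have : ∃ k ∉ ({i, j} : Finset (Fin (n+3))), k ∈ (Finset.univ : Finset (Fin (n+3))) := by
        by_contra hcon
        push Not at hcon
        have h1 : (Finset.univ : Finset (Fin (n+3))) ⊆ {i, j} := fun x hx => by
          by_contra h; exact hcon x h hx
        have := (Finset.card_le_card h1).trans Finset.card_le_two
        simp at this
      obtain ⟨k, hk, _⟩ := this
      simp at hk
      exact ⟨k, hk.1, hk.2⟩
    have htm : t ≤ m := by
      by_contra h
      have := hj j hji
      rw [coeff_eq_zero_of_natDegree_lt (by omega)] at ht
      exact not_isUnit_zero ht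
    obtain ⟨p, q, hp, hq⟩ := suslin_aux m (f' i) hd ⟨u, hu⟩ (m - t) (f' j) t (by omega)
      (hj j hji) ht
    by_cases hku : IsUnit ((f' k).coeff m)
    · exact ih f' k hUm (hj k hki) hku
    · have h1 := (Rq.step hki p f').trans (Rq.step hkj q _)
      refine h1.trans (ih _ k (hUm.rq h1) ?_ ?_)
      · simp [Ne.symm hkj]
        rw [add_assoc]
        exact natDegree_add_le_of_degree_le (hj k hki) hp
      · simp only [Function.update_self, Function.update_of_ne (Ne.symm hkj)]
        by_contra hcon
        have h5 : ¬ IsUnit (-(f' k).coeff m) := by rwa [IsUnit.neg_iff]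
        have := IsLocalRing.nonunits_add hcon h5
        rw [add_assoc, coeff_add, add_neg_cancel_comm] at this
        exact this hq
end local_
end YC

namespace YC
set_option linter.unusedSectionVars false
set_option linter.unusedSimpArgs false

lemma krullDim_succ_le {α β : Type*} [Preorder α] [Preorder β] (g : α → β) (hg : StrictMono g)
    (b : β) (hb : ∀ x, g x < b) : Order.krullDim α + 1 ≤ Order.krullDim β := by
  cases isEmpty_or_nonempty α with
  | inl h => rw [Order.krullDim_eq_bot]; simp
  | inr h =>
    have : Nonempty β := ⟨b⟩
    rw [Order.krullDim_eq_iSup_length,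
    Order.krullDim_eq_iSup_length, ← WithBot.coe_one, ← WithBot.coe_add,
    ENat.iSup_add, WithBot.coe_le_coe, iSup_le_iff]
    intro l
    refine le_trans ?_ (le_iSup _ (RelSeries.snoc (l.map g hg) b (hb _)))
    exact le_of_eq (by norm_cast)

lemma dim_integral {B C : Type*} [CommRing B] [CommRing C] [Algebra B C]
    [Algebra.IsIntegral B C] : ringKrullDim C ≤ ringKrullDim B :=
  Order.krullDim_le_of_strictMono (fun q => PrimeSpectrum.comap (algebraMap B C) q)
    (fun _ _ h => Ideal.IsIntegral.comap_lt_comap h)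

lemma dim_quot_poly {R : Type*} [CommRing R] [IsLocalRing R] (a : R) (ha : ¬ IsUnit a)
    (f : R[X]) (k m : ℕ) (hd : f.natDegree ≤ m) (hc : f.coeff m = a ^ k)
    (hu : IsUnit (Ideal.Quotient.mk (Ideal.span {f}) (C a))) :
    ringKrullDim (R[X] ⧸ Ideal.span {f}) + 1 ≤ ringKrullDim R := by
  let B := Localization.Away a
  let Q := R[X] ⧸ Ideal.span {f}
  let j : R →+* Q := (Ideal.Quotient.mk (Ideal.span {f})).comp C
  let ι : B →+* Q := IsLocalization.Away.lift (g := j) a hu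
  have hι : ∀ r, ι (algebraMap R B r) = j r := fun r => IsLocalization.Away.lift_eq a hu r
  let _ : Algebra B Q := ι.toAlgebra
  have hX : IsIntegral B (Ideal.Quotient.mk (Ideal.span {f}) X : Q) := by
    have hau : IsUnit (algebraMap R B a) := IsLocalization.Away.algebraMap_isUnit a
    obtain ⟨u, hu⟩ := hau
    refine ⟨C (↑(u ^ k)⁻¹ : B) * f.map (algebraMap R B), ?_, ?_⟩
    · refine monic_of_natDegree_le_of_coeff_eq_one m ?_ ?_
      · exact (natDegree_C_mul_le _ _).trans (natDegree_map_le.trans hd)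
      · rw [coeff_C_mul, coeff_map, hc, map_pow, ← hu, ← Units.val_pow_eq_pow_val]
        exact Units.inv_mul _
    · rw [eval₂_mul, eval₂_map]
      have : (algebraMap B Q).comp (algebraMap R B) = j := RingHom.ext hι
      rw [this]
      have e : eval₂ j (Ideal.Quotient.mk (Ideal.span {f}) X) f =
          Ideal.Quotient.mk (Ideal.span {f}) f := by
        rw [← hom_eval₂, eval₂_C_X]
      rw [e, Ideal.Quotient.eq_zero_iff_mem.mpr (Ideal.mem_span_singleton_self f), mul_zero]
  have hIntg : Algebra.IsIntegral B Q := ⟨fun x => by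
    obtain ⟨p, rfl⟩ := Ideal.Quotient.mk_surjective x
    induction p using Polynomial.induction_on with
    | C r =>
      have : Ideal.Quotient.mk (Ideal.span {f}) (C r) = algebraMap B Q (algebraMap R B r) :=
        (hι r).symm
      rw [this]; exact isIntegral_algebraMap
    | add p q hp hq => rw [map_add]; exact hp.add hq
    | monomial n r h =>
      rw [pow_succ, ← mul_assoc, map_mul]
      exact h.mul hX⟩
  let g1 : PrimeSpectrum Q → PrimeSpectrum B := PrimeSpectrum.comap (algebraMap B Q)
  have hg1 : StrictMono g1 := fun _ _ h => Ideal.IsIntegral.comap_lt_comap h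
  let g2 : PrimeSpectrum B → PrimeSpectrum R := PrimeSpectrum.comap (algebraMap R B)
  have hg2 : StrictMono g2 := by
    refine Monotone.strictMono_of_injective (fun p q h => Ideal.comap_mono h) ?_
    exact PrimeSpectrum.localization_comap_injective B (Submonoid.powers a)
  refine krullDim_succ_le (g2 ∘ g1) (hg2.comp hg1) (IsLocalRing.closedPoint R) (fun x => ?_)
  refine lt_of_le_of_ne (IsLocalRing.le_maximalIdeal (g2 (g1 x)).2.ne_top) ?_
  intro h
  have ham : a ∈ (g2 (g1 x)).asIdeal := by
    have h' : g2 (g1 x) = IsLocalRing.closedPoint R := h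
    rw [h']; exact ha
  have : algebraMap R B a ∈ (g1 x).asIdeal := ham
  exact (g1 x).2.ne_top (Ideal.eq_top_of_isUnit_mem _ this
    (IsLocalization.Away.algebraMap_isUnit a))
end YC

namespace YC
set_option linter.unusedSectionVars false
set_option linter.unusedSimpArgs false

def Pr {R : Type*} [CommRing R] (a : R) (g : R[X]) : Prop :=
  ∃ k m : ℕ, g.natDegree ≤ m ∧ g.coeff m = a ^ k

lemma Pr.add {R : Type*} [CommRing R] {a : R} {g : R[X]} (h : Pr a g) (p : R[X]) :
    Pr a (p + X ^ (p.natDegree + 1) * g) := by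
  obtain ⟨k, m, h1, h2⟩ := h
  refine ⟨k, (m + (p.natDegree + 1)), ?_, ?_⟩
  · refine natDegree_add_le_of_degree_le (by omega) ?_
    refine natDegree_mul_le.trans ?_
    have := natDegree_X_pow_le (R := R) (p.natDegree + 1)
    omega
  · rw [coeff_add, coeff_X_pow_mul, h2, coeff_eq_zero_of_natDegree_lt (by omega), zero_add]

lemma Pr.smul {R : Type*} [CommRing R] {a : R} {g : R[X]} (h : Pr a g) : Pr a (C a * g) := by
  obtain ⟨k, m, h1, h2⟩ := h
  exact ⟨k + 1, m, (natDegree_C_mul_le _ _).trans h1, by rw [coeff_C_mul, h2, pow_succ']⟩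

lemma lift_moves {R : Type*} [CommRing R] {n : Type*} [Fintype n] [DecidableEq n] (a : R)
    {R' : Type*} [CommRing R'] (π : R →+* R') (hπ : Function.Surjective π) (ha : π a = 0)
    (f : n → R[X]) (hf : ∀ i, Pr a (f i)) (w' : n → R'[X])
    (h : Rq (mapRingHom π ∘ f) w') :
    ∃ w, Rq f w ∧ mapRingHom π ∘ w = w' ∧ ∀ i, Pr a (w i) := by
  refine Rq.induct (motive := fun w' => ∃ w, Rq f w ∧ mapRingHom π ∘ w = w' ∧ ∀ i, Pr a (w i)) h
    ⟨f, Rq.refl _, rfl, hf⟩ ?_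
  · rintro u i j c hij ⟨w, hw, rfl, hPr⟩
    obtain ⟨c, rfl⟩ := Polynomial.map_surjective π hπ c
    refine ⟨_, hw.trans (Rq.step hij (c + X ^ ((w i + c * w j).natDegree + 1) * C a) w), ?_, ?_⟩
    · ext1 k
      by_cases hk : k = i
      · subst hk; simp [ha]
      · simp [hk]
    · intro k
      by_cases hk : k = i
      · subst hk
        have := (hPr j).smul.add (w k + c * w j)
        rw [Function.update_self]
        convert this using 1
        ring
      · rw [Function.update_of_ne hk]; exact hPr k

lemma lift_tail {D Q : Type*} [CommRing D] [CommRing Q] {n : ℕ} (π : D →+* Q)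
    (hπ : Function.Surjective π) (w : Fin (n+1) → D) (u' : Fin n → Q)
    (h : Rq (fun i : Fin n => π (w i.succ)) u') :
    ∃ u, Rq w u ∧ u 0 = w 0 ∧ (fun i : Fin n => π (u i.succ)) = u' := by
  refine Rq.induct (motive := fun u' => ∃ u, Rq w u ∧ u 0 = w 0 ∧
    (fun i : Fin n => π (u i.succ)) = u') h ⟨w, Rq.refl _, rfl, rfl⟩ ?_
  · rintro v i j c hij ⟨u, hu, hu0, rfl⟩
    obtain ⟨c, rfl⟩ := hπ c
    have hij' : i.succ ≠ j.succ := fun h => hij (Fin.succ_injective _ h)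
    refine ⟨_, hu.trans (Rq.step hij' c u), ?_, ?_⟩
    · rw [Function.update_of_ne (Fin.succ_ne_zero i).symm, hu0]
    · ext1 k
      by_cases hk : k = i
      · subst hk; simp
      · simp [hk]

lemma local_end {R : Type*} [CommRing R] [IsLocalRing R] {n : ℕ}
    (hdim : ringKrullDim R < (n + 2 : ℕ)) (a : R) (ha : ¬ IsUnit a) (w : Fin (n+3) → R[X])
    (hw : Um w) (hPr : Pr a (w 0)) (h : ∃ h : R[X], w 0 = 1 + C a * h) :
    Rq w (Pi.single 0 1) := by
  obtain ⟨k, m, hd, hc⟩ := hPr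
  set π := Ideal.Quotient.mk (Ideal.span {w 0}) with hπ
  have h0 : π (w 0) = 0 := Ideal.Quotient.eq_zero_iff_mem.mpr (Ideal.mem_span_singleton_self _)
  have hu : IsUnit (π (C a)) := by
    obtain ⟨h, hh⟩ := h
    have := congrArg π hh
    rw [h0, map_add, map_mul, map_one] at this
    exact IsUnit.of_mul_eq_one (-π h) (by linear_combination this)
  have hdQ := lt_of_succ_le (dim_quot_poly a ha (w 0) k m hd hc hu) hdim
  have hUm : Um (fun i : Fin (n+2) => π (w i.succ)) := by
    obtain ⟨c, hc⟩ := hw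
    refine ⟨fun i => π (c i.succ), ?_⟩
    have := congrArg π hc
    rw [Fin.sum_univ_succ] at this
    simpa [h0] using this
  obtain ⟨u, hu, hu0, hu1⟩ := lift_tail π Ideal.Quotient.mk_surjective w _ (Rq_of_dim hdQ _ hUm)
  have h1 : π (u 1) = 1 := by
    have := congrFun hu1 0
    simpa using this
  rw [← map_one π, Ideal.Quotient.eq, Ideal.mem_span_singleton] at h1
  obtain ⟨g, hg⟩ := h1
  have h10 : (1 : Fin (n+3)) ≠ 0 := by simp
  refine hu.trans ((Rq.step h10 (-g) u).trans (Rq_of_unit _ 1 ?_))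
  rw [Function.update_self]
  have : u 1 + -g * u 0 = 1 := by rw [hu0]; linear_combination hg
  rw [this]; exact isUnit_one

theorem local_thm {n : ℕ} (N : ℕ) : ∀ (R : Type*) [CommRing R] [IsLocalRing R],
    ringKrullDim R < (n + 2 : ℕ) → ∀ f : Fin (n+3) → R[X], Um f →
    ∑ i, (f i).support.card ≤ N → Rq f (Pi.single 0 1) := by
  induction N with
  | zero =>
    intro R _ _ hdim f hf hN
    exfalso
    have h0 : ∀ i, f i = 0 := by
      intro i
      have : ∑ i, (f i).support.card = 0 := by omega
      rw [Finset.sum_eq_zero_iff] at this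
      simpa using this i (Finset.mem_univ _)
    obtain ⟨c, hc⟩ := hf
    simp [h0] at hc
  | succ N ih =>
    intro R _ _ hdim f hf hN
    obtain ⟨i, hi⟩ : ∃ i, f i ≠ 0 := by
      by_contra hcon
      push Not at hcon
      obtain ⟨c, hc⟩ := hf
      simp [hcon] at hc
    set a := (f i).leadingCoeff with ha
    by_cases hau : IsUnit a
    · exact horrocks _ f i hf le_rfl hau
    have hPr0 : Pr a (f i) := ⟨1, _, le_rfl, by simp [ha]⟩
    let R' := R ⧸ Ideal.span {a}
    let π : R →+* R' := Ideal.Quotient.mk _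
    have hπ : Function.Surjective π := Ideal.Quotient.mk_surjective
    have hπa : π a = 0 := Ideal.Quotient.eq_zero_iff_mem.mpr (Ideal.mem_span_singleton_self _)
    have : Nontrivial R' := Ideal.Quotient.nontrivial_iff.mpr (by
      rwa [Ne, Ideal.span_singleton_eq_top])
    have : IsLocalRing R' := IsLocalRing.of_surjective' π hπ
    have hR' : Rq (mapRingHom π ∘ f) (Pi.single 0 1) := by
      refine ih R' (lt_of_le_of_lt (ringKrullDim_quotient_le _) hdim) _ (hf.map _) ?_
      have : ∑ j, ((mapRingHom π ∘ f) j).support.card < ∑ j, (f j).support.card := by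
        refine Finset.sum_lt_sum (fun j _ => Finset.card_le_card (support_map_subset _ _))
          ⟨i, Finset.mem_univ _, Finset.card_lt_card ?_⟩
        refine Finset.ssubset_iff_subset_ne.mpr ⟨support_map_subset _ _, fun h => ?_⟩
        have h1 : (f i).natDegree ∈ (f i).support := natDegree_mem_support_of_nonzero hi
        rw [← h] at h1
        simp only [Function.comp_apply, coe_mapRingHom, mem_support_iff, coeff_map] at h1
        exact h1 hπa
      omega
    -- make all entries Pr
    have hr := Rq.pour i (Finset.univ.erase i) (by simp) (fun j => X ^ ((f j).natDegree + 1)) f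
    set f1 := (fun j => if j ∈ Finset.univ.erase i then
      f j + X ^ ((f j).natDegree + 1) * f i else f j) with hf1
    have hPr1 : ∀ j, Pr a (f1 j) := by
      intro j
      by_cases hj : j = i
      · subst hj; simpa [hf1] using hPr0
      · simpa [hf1, hj] using hPr0.add (f j)
    clear_value f1
    obtain ⟨w, hw, hw', hPr⟩ := lift_moves a π hπ hπa f1 hPr1 _
      ((hr.map (mapRingHom π)).symm.trans hR')
    refine hr.trans (hw.trans (local_end hdim a hau w ((hf.rq hr).rq hw) (hPr 0) ?_))
    have h0 := congrFun hw' 0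
    simp only [Function.comp_apply, coe_mapRingHom, Pi.single_eq_same] at h0
    have : w 0 - 1 ∈ Ideal.map C (Ideal.span {a}) := by
      rw [Ideal.mem_map_C_iff]
      intro k
      rw [← Ideal.Quotient.eq_zero_iff_mem]
      have := congrArg (fun q => coeff q k) h0
      simp only [coeff_map] at this
      rw [coeff_sub, map_sub, sub_eq_zero]
      refine this.trans ?_
      rw [coeff_one, coeff_one]
      split_ifs <;> simp
    rw [Ideal.map_span, Set.image_singleton, Ideal.mem_span_singleton] at this
    obtain ⟨h, hh⟩ := this
    exact ⟨h, by linear_combination hh⟩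

lemma fin3 {n : ℕ} (i j : Fin (n+3)) : ∃ k, k ≠ i ∧ k ≠ j := by
  have : ∃ k ∉ ({i, j} : Finset (Fin (n+3))), k ∈ (Finset.univ : Finset (Fin (n+3))) := by
    by_contra hcon
    push Not at hcon
    have h1 : (Finset.univ : Finset (Fin (n+3))) ⊆ {i, j} := fun x hx => by
      by_contra h; exact hcon x h hx
    have := (Finset.card_le_card h1).trans Finset.card_le_two
    simp at this
  obtain ⟨k, hk, _⟩ := this
  simp at hk
  exact ⟨k, hk.1, hk.2⟩

lemma map_single0 {D D' : Type*} [CommRing D] [CommRing D'] (φ : D →+* D') {n : Type*}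
    [DecidableEq n] (z : n) : φ ∘ (Pi.single z 1 : n → D) = Pi.single z 1 := by
  ext1 i
  by_cases hi : i = z
  · subst hi; simp
  · simp [hi]

theorem yengui {n : ℕ} (R : Type*) [CommRing R] (hdim : ringKrullDim R < (n + 2 : ℕ))
    (f : Fin (n+3) → R[X]) (hf : Um f) : Rq f (Pi.single 0 1) := by
  have h1 := LG fin3 f (Pi.single 0 1) (fun m _ => by
    have hd : ringKrullDim (Localization.AtPrime m) < (n + 2 : ℕ) :=
      lt_of_le_of_lt (by
        refine Order.krullDim_le_of_strictMono (PrimeSpectrum.comap (algebraMap R _)) ?_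
        refine Monotone.strictMono_of_injective (fun p q h => Ideal.comap_mono h) ?_
        exact PrimeSpectrum.localization_comap_injective _ m.primeCompl) hdim
    have := local_thm _ (Localization.AtPrime m) hd
      (mapRingHom (algebraMap R (Localization.AtPrime m)) ∘ f) (hf.map _) le_rfl
    rw [← map_single0 ((C : _ →+* (Localization.AtPrime m)[X]).comp (algebraMap R _))] at this
    exact this)
  refine h1.trans ?_
  have h2 := Rq_of_dim hdim (evalRingHom (0 : R) ∘ f) (hf.map (evalRingHom (0 : R)))
  have h3 := h2.map (C : R →+* R[X])
  rw [map_single0] at h3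
  exact h3

end YC

namespace YC
set_option linter.unusedSectionVars false
set_option linter.unusedSimpArgs false
open Matrix

/-- the double of `R` along the ideal `τR`. -/
def Dbl (R : Type*) [CommRing R] (τ : R) : Subalgebra R (R × R) where
  carrier := {p | ∃ h, p.1 - p.2 = τ * h}
  mul_mem' := by
    rintro ⟨a, b⟩ ⟨c, d⟩ ⟨h, hh⟩ ⟨k, hk⟩
    exact ⟨h * c + b * k, by simp only [Prod.mk_mul_mk] at *; linear_combination c * hh + b * hk⟩
  add_mem' := by
    rintro ⟨a, b⟩ ⟨c, d⟩ ⟨h, hh⟩ ⟨k, hk⟩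
    exact ⟨h + k, by simp only [Prod.mk_add_mk] at *; linear_combination hh + hk⟩
  algebraMap_mem' := by
    intro r; exact ⟨0, by simp [Prod.algebraMap_apply]⟩

section
variable {R : Type*} [CommRing R] (τ : R)

instance : Algebra.IsIntegral R (Dbl R τ) := ⟨by
  rintro ⟨⟨a, b⟩, hx⟩
  refine ⟨(X - C a) * (X - C b), (monic_X_sub_C a).mul (monic_X_sub_C b), ?_⟩
  rw [eval₂_mul, eval₂_sub, eval₂_sub, eval₂_X, eval₂_C, eval₂_C]
  apply Subtype.ext
  apply Prod.ext
  · simp [Prod.algebraMap_apply]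
  · simp [Prod.algebraMap_apply]⟩

def p1 : Dbl R τ →+* R := (RingHom.fst R R).comp (Dbl R τ).val.toRingHom
def p2 : Dbl R τ →+* R := (RingHom.snd R R).comp (Dbl R τ).val.toRingHom
def ep : Dbl R τ := ⟨(τ, 0), ⟨1, by simp⟩⟩

lemma p1_ep : p1 τ (ep τ) = τ := rfl
lemma p2_ep : p2 τ (ep τ) = 0 := rfl
lemma p1_alg (r : R) : p1 τ (algebraMap R _ r) = r := rfl
lemma p2_alg (r : R) : p2 τ (algebraMap R _ r) = r := rfl
lemma ep_mul : ep τ * ep τ = algebraMap R (Dbl R τ) τ * ep τ := by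
  apply Subtype.ext
  apply Prod.ext
  · rfl
  · show (0 : R) * 0 = τ * 0
    simp

lemma p_diff (c : (Dbl R τ)[X]) : ∃ h : R[X], c.map (p1 τ) = c.map (p2 τ) + C τ * h := by
  have : c.map (p1 τ) - c.map (p2 τ) ∈ Ideal.map C (Ideal.span {τ}) := by
    rw [Ideal.mem_map_C_iff]
    intro k
    rw [coeff_sub, coeff_map, coeff_map, Ideal.mem_span_singleton]
    obtain ⟨h, hh⟩ := (c.coeff k).2
    exact ⟨h, hh⟩
  rw [Ideal.map_span, Set.image_singleton, Ideal.mem_span_singleton] at this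
  obtain ⟨h, hh⟩ := this
  exact ⟨h, by linear_combination hh⟩
end

lemma comm_id {E : Type*} [Ring E] (N M : E) (hNN : N * N = 0) (hMM : M * M = 0)
    (hMN : M * N = 0) : (1 + N) * (1 + M) * ((1 + -N) * (1 + -M)) = 1 + N * M := by
  have hNMM : N * (M * M) = 0 := by rw [hMM, mul_zero]
  have hNMN : N * (M * N) = 0 := by rw [hMN, mul_zero]
  have hMNM : M * (N * M) = 0 := by rw [← mul_assoc, hMN, zero_mul]
  have hNNM : N * (N * M) = 0 := by rw [← mul_assoc, hNN, zero_mul]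
  simp only [mul_add, add_mul, mul_neg, neg_mul, mul_assoc, one_mul, mul_one, hNN, hMM, hMN,
    hNMM, hNMN, hMNM, hNNM, mul_zero]
  abel

/-- relative elementary monoid -/
def Hm {n : Type*} [Fintype n] [DecidableEq n] (z : n) {D : Type*} [CommRing D] (t : D) :
    Submonoid (Matrix n n D) :=
  Submonoid.closure {M | ∃ (j : n) (c : D), j ≠ z ∧
    (M = transvection z j (t * c) ∨ M = transvection j z (t * c))}

lemma Hm_mem {n : Type*} [Fintype n] [DecidableEq n] (z : n) {D : Type*} [CommRing D] (t : D)
    (i j : n) (c : D) (hij : i ≠ j) : transvection i j (t ^ 2 * c) ∈ Hm z t := by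
  have e : t ^ 2 * c = t * (t * c) := by ring
  by_cases hi : i = z
  · subst hi
    rw [e]
    exact Submonoid.subset_closure ⟨j, t * c, Ne.symm hij, Or.inl rfl⟩
  by_cases hj : j = z
  · subst hj
    rw [e]
    exact Submonoid.subset_closure ⟨i, t * c, hij, Or.inr rfl⟩
  have a1 : transvection i z (t * 1) ∈ Hm z t := Submonoid.subset_closure ⟨i, 1, hi, Or.inr rfl⟩
  have a2 : transvection z j (t * c) ∈ Hm z t := Submonoid.subset_closure ⟨j, c, hj, Or.inl rfl⟩
  have a3 : transvection i z (t * -1) ∈ Hm z t := Submonoid.subset_closure ⟨i, -1, hi, Or.inr rfl⟩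
  have a4 : transvection z j (t * -c) ∈ Hm z t := Submonoid.subset_closure ⟨j, -c, hj, Or.inl rfl⟩
  have := mul_mem (mul_mem a1 a2) (mul_mem a3 a4)
  have en : ∀ (x y : n) (s d : D), transvection x y (s * -d) = 1 + -(Matrix.single x y (s * d)) := by
    intro x y s d
    rw [transvection, mul_neg, single_neg]
  rw [en, en] at this
  unfold transvection at this
  rw [comm_id] at this
  · convert this using 1
    rw [transvection, single_mul_single_same]
    congr 2; ring
  · rw [single_mul_single_of_ne]; exact (Ne.symm hi)
  · rw [single_mul_single_of_ne]; exact hj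
  · rw [single_mul_single_of_ne]; exact (Ne.symm hij)

theorem relative_aux {m : ℕ} {R D : Type*} [CommRing R] [CommRing D] (io : R →+* D)
    (p1 p2 : D →+* R) (ep : D) (t τ : R) (hτ : τ = t ^ 4)
    (p1_alg : ∀ r, p1 (io r) = r) (p1_ep : p1 ep = τ) (p2_ep : p2 ep = 0)
    (ep_mul : ep * ep = io τ * ep)
    (p_diff : ∀ c : D[X], ∃ h : R[X], c.map p1 = c.map p2 + C τ * h)
    (hdim' : ringKrullDim D < (m + 2 : ℕ)) (u : Fin (m+3) → R[X])
    (hw : Um ((Pi.single 0 1 : Fin (m+3) → R[X]) + C τ • u)) :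
    ∃ g ∈ Hm (0 : Fin (m+3)) (C t : R[X]),
      g.mulVec ((Pi.single 0 1 : Fin (m+3) → R[X]) + C τ • u) = Pi.single 0 1 := by
  let al : R[X] →+* D[X] := mapRingHom io
  let W : Fin (m+3) → D[X] := Pi.single 0 1 + C ep • (al ∘ u)
  have hee : C ep * C ep = al (C τ) * C ep := by
    simp only [al, coe_mapRingHom, map_C]
    rw [← map_mul, ← map_mul, ep_mul]
  have hUm : Um W := by
    obtain ⟨c, hc⟩ := hw
    set S := ∑ i, c i * u i with hS
    have hc' : c 0 + C τ * S = 1 := by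
      rw [← hc, hS, Finset.mul_sum]
      simp only [Pi.add_apply, mul_add, Finset.sum_add_distrib, Pi.smul_apply, smul_eq_mul]
      congr 1
      · simp [Pi.single_apply]
      · exact Finset.sum_congr rfl fun i _ => by ring
    refine ⟨al ∘ c + Pi.single 0 ((al (C τ) - C ep) * al S), ?_⟩
    have hc'' : al (c 0) + al (C τ) * al S = 1 := by
      rw [← map_mul, ← map_add, hc', map_one]
    have e1 : ∑ i, (al ∘ c) i * W i = al (c 0) + C ep * al S := by
      simp only [W, Pi.add_apply, mul_add, Finset.sum_add_distrib, Pi.smul_apply, smul_eq_mul]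
      congr 1
      · simp [Pi.single_apply]
      · rw [hS, map_sum, Finset.mul_sum]
        exact Finset.sum_congr rfl fun i _ => by rw [map_mul]; simp only [Function.comp_apply]; ring
    have e2 : ∑ i, (Pi.single 0 ((al (C τ) - C ep) * al S) : Fin (m+3) → D[X]) i * W i
        = (al (C τ) - C ep) * al S * (1 + C ep * al (u 0)) := by
      rw [Finset.sum_eq_single 0]
      · simp only [Pi.single_eq_same, W, Pi.add_apply, Pi.smul_apply, smul_eq_mul, Function.comp_apply]
      · intro b _ hb; simp [hb]
      · simp
    simp only [Pi.add_apply, add_mul, Finset.sum_add_distrib]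
    rw [e1, e2]
    linear_combination hc'' - al S * al (u 0) * hee
  obtain ⟨E, hE, hEW⟩ := yengui D hdim' W hUm
  let π1 : D[X] →+* R[X] := mapRingHom p1
  let π2 : D[X] →+* R[X] := mapRingHom p2
  have key : ∀ E ∈ El (Fin (m+3)) D[X], ∃ g ∈ Hm (0 : Fin (m+3)) (C t : R[X]),
      π1.mapMatrix E = π2.mapMatrix E * g := by
    intro E hE
    induction hE using Submonoid.closure_induction_left with
    | one => exact ⟨1, one_mem _, by simp⟩
    | mul_left x hx E' hE' ih =>
      obtain ⟨i, j, α, hij, rfl⟩ := hx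
      obtain ⟨g, hg, hg'⟩ := ih
      obtain ⟨γ, _, h1, h2⟩ := El_inv (El_map π2 hE')
      obtain ⟨h, hh⟩ := p_diff α
      set δ := π2.mapMatrix E' with hδ
      have hT := TL (Hm (0 : Fin (m+3)) (C t : R[X])) (C t ^ 2)
        (fun i j c hij => Hm_mem _ _ i j c hij) fin3 (δ.row j) (γ.col i) (γ.col j) 1 h
        (by
          have := congrFun (congrFun h1 j) i
          rw [Matrix.mul_apply, Matrix.one_apply_ne hij.symm] at this
          exact this)
        (by
          have := congrFun (congrFun h1 j) j
          rw [Matrix.mul_apply, Matrix.one_apply_eq] at this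
          rw [dotProduct_comm]
          exact this)
      refine ⟨_, mul_mem hT hg, ?_⟩
      rw [map_mul, map_mul, map_trans, map_trans, hg', ← hδ]
      have e1 : π1 α = π2 α + C τ * h := hh
      rw [e1, ← transvection_mul_transvection_same _ _ hij]
      have e2 := conj_trans γ δ h2 i j (C τ * h)
      have e3 : (C t : R[X]) ^ 2 ^ 2 = 0 ∨ True := Or.inr trivial
      have e4 : ((C t ^ 2) ^ 2 * 1 * h : R[X]) = C τ * h := by
        rw [hτ, map_pow]; ring
      rw [e4]
      have e5 : transvection i j (C τ * h) * δ =
          δ * (1 + vecMulVec ((C τ * h) • γ.col i) (δ.row j)) := by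
        calc transvection i j (C τ * h) * δ = δ * γ * transvection i j (C τ * h) * δ := by
              rw [h1, one_mul]
          _ = δ * ((1 + vecMulVec ((C τ * h) • γ.col i) (δ.row j)) * γ) * δ := by
              rw [← e2]; simp only [mul_assoc]
          _ = δ * (1 + vecMulVec ((C τ * h) • γ.col i) (δ.row j)) * (γ * δ) := by
              simp only [mul_assoc]
          _ = _ := by rw [h2, mul_one]
      calc transvection i j (π2 α) * transvection i j (C τ * h) * (δ * g)
          = transvection i j (π2 α) * (transvection i j (C τ * h) * δ) * g := by
            simp only [mul_assoc]
        _ = _ := by rw [e5]; simp only [mul_assoc]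
  obtain ⟨g, hg, hEg⟩ := key E hE
  refine ⟨g, hg, ?_⟩
  have al1 : ∀ q, π1 (al q) = q := by
    intro q
    have : π1.comp al = RingHom.id _ := by
      apply Polynomial.ringHom_ext
      · intro r; simp [π1, al, p1_alg]
      · simp [π1, al]
    exact RingHom.congr_fun this q
  have hW1 : π1 ∘ W = (Pi.single 0 1 : Fin (m+3) → R[X]) + C τ • u := by
    ext1 i
    have : π1 ((Pi.single 0 1 : Fin (m+3) → D[X]) i) = (Pi.single 0 1 : Fin (m+3) → R[X]) i :=
      congrFun (map_single0 π1 (0 : Fin (m+3))) i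
    simp only [W, Function.comp_apply, Pi.add_apply, map_add, this, Pi.smul_apply, smul_eq_mul,
      map_mul, al1]
    simp [π1, p1_ep]
  have hW2 : π2 ∘ W = (Pi.single 0 1 : Fin (m+3) → R[X]) := by
    ext1 i
    have : π2 ((Pi.single 0 1 : Fin (m+3) → D[X]) i) = (Pi.single 0 1 : Fin (m+3) → R[X]) i :=
      congrFun (map_single0 π2 (0 : Fin (m+3))) i
    simp only [W, Function.comp_apply, Pi.add_apply, map_add, this, Pi.smul_apply, smul_eq_mul,
      map_mul]
    simp [π2, p2_ep]
  have r1 := map_mulVec' π1 E W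
  have r2 := map_mulVec' π2 E W
  rw [hEW, map_single0, hW1, hEg, ← mulVec_mulVec] at r1
  rw [hEW, map_single0, hW2] at r2
  obtain ⟨γ, _, h1, h2⟩ := El_inv (El_map π2 hE)
  have := congrArg (γ.mulVec) (r1.trans r2.symm)
  simpa only [mulVec_mulVec, ← mul_assoc, h2, one_mul, one_mulVec] using this

theorem relative {m : ℕ} {R : Type*} [CommRing R] (hdim : ringKrullDim R < (m + 2 : ℕ))
    (t : R) (u : Fin (m+3) → R[X])
    (hw : Um ((Pi.single 0 1 : Fin (m+3) → R[X]) + C (t ^ 4) • u)) :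
    ∃ g ∈ Hm (0 : Fin (m+3)) (C t : R[X]),
      g.mulVec ((Pi.single 0 1 : Fin (m+3) → R[X]) + C (t ^ 4) • u) = Pi.single 0 1 := by
  exact relative_aux (algebraMap R (Dbl R (t ^ 4))) (p1 _) (p2 _) (ep (t ^ 4)) t (t ^ 4) rfl (p1_alg _)
    (p1_ep _) (p2_ep _) (ep_mul _) (p_diff _) (lt_of_le_of_lt (dim_integral (B := R)) hdim) u hw
end YC

namespace YC
set_option linter.unusedSectionVars false
set_option linter.unusedSimpArgs false
open Matrix

/-- reduction of coefficients -/
noncomputable def rho {R : Type*} [CommRing R] (I : Ideal R) : R[X] →+* (R ⧸ I)[X] :=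
  mapRingHom (Ideal.Quotient.mk I)

def shearP {A P : Type*} [CommRing A] [AddCommGroup P] [Module A P] (p : P) :
    (P × A) ≃ₗ[A] (P × A) where
  toFun v := (v.1 + v.2 • p, v.2)
  invFun v := (v.1 - v.2 • p, v.2)
  left_inv v := by simp
  right_inv v := by simp
  map_add' v w := by
    ext
    · simp only [Prod.fst_add, Prod.snd_add, add_smul]; abel
    · rfl
  map_smul' c v := by
    ext
    · simp [mul_smul, smul_add]
    · rfl

def shearF {A P : Type*} [CommRing A] [AddCommGroup P] [Module A P] (φ : P →ₗ[A] A) :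
    (P × A) ≃ₗ[A] (P × A) where
  toFun v := (v.1, v.2 + φ v.1)
  invFun v := (v.1, v.2 - φ v.1)
  left_inv v := by simp
  right_inv v := by simp
  map_add' v w := by
    ext
    · rfl
    · simp only [Prod.fst_add, Prod.snd_add, map_add]; abel
  map_smul' c v := by
    ext
    · rfl
    · simp [mul_add]

section
variable {R : Type*} [CommRing R] {P : Type*} [AddCommGroup P] [Module R[X] P]

/-- concrete version of the property -/
def Om (R : Type*) [CommRing R] (P : Type*) [AddCommGroup P] [Module R[X] P] (r : ℕ) : Prop :=
  ∀ I : Ideal R, ∃ t : R, Ideal.Quotient.mk I t ∈ nonZeroDivisors (R ⧸ I) ∧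
    ∃ (e : Fin r → P) (ψ : Fin r → (P →ₗ[R[X]] R[X])),
      (∀ i j, rho I (ψ i (e j)) = if i = j then C (Ideal.Quotient.mk I t) else 0) ∧
      ∀ (q : P) (φ : P →ₗ[R[X]] R[X]),
        C (Ideal.Quotient.mk I t) * rho I (φ q) = ∑ i, rho I (ψ i q) * rho I (φ (e i))

/-- row of an element -/
noncomputable def row {r : ℕ} (I : Ideal R) (ψ : Fin r → (P →ₗ[R[X]] R[X])) (v : P × R[X]) :
    Fin (r + 1) → (R ⧸ I)[X] :=
  Fin.cons (rho I v.2) (fun i => rho I (ψ i v.1))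

lemma rho_surj (I : Ideal R) : Function.Surjective (rho I) :=
  Polynomial.map_surjective _ Ideal.Quotient.mk_surjective

lemma lift_mat {r : ℕ} (I : Ideal R) (t : R) (e : Fin r → P) (ψ : Fin r → (P →ₗ[R[X]] R[X]))
    (h : ∀ i j, rho I (ψ i (e j)) = if i = j then C (Ideal.Quotient.mk I t) else 0)
    (g : Matrix (Fin (r+1)) (Fin (r+1)) (R ⧸ I)[X])
    (hg : g ∈ Hm (0 : Fin (r+1)) (C (Ideal.Quotient.mk I t))) (v : P × R[X]) :
    ∃ G : (P × R[X]) ≃ₗ[R[X]] (P × R[X]), row I ψ (G v) = g.mulVec (row I ψ v) := by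
  induction hg using Submonoid.closure_induction_left with
  | one => exact ⟨LinearEquiv.refl _ _, by simp⟩
  | mul_left x hx E' hE' ih =>
    obtain ⟨G, hG⟩ := ih
    obtain ⟨j, c, hj, hx⟩ := hx
    obtain ⟨c', rfl⟩ := rho_surj I c
    obtain ⟨j, rfl⟩ := Fin.exists_succ_eq.mpr hj
    have hCt : rho I (C t) = C (Ideal.Quotient.mk I t) := by simp [rho]
    rw [← hCt] at hx
    rcases hx with rfl | rfl
    · refine ⟨G.trans (shearF ((C t * c') • ψ j)), ?_⟩
      rw [← mulVec_mulVec, ← hG, trans_mulVec]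
      ext1 i
      refine Fin.cases ?_ (fun i => ?_) i
      · simp [row, shearF]
      · simp [row, shearF, Function.update_of_ne]
    · refine ⟨G.trans (shearP (c' • e j)), ?_⟩
      rw [← mulVec_mulVec, ← hG, trans_mulVec]
      ext1 i
      refine Fin.cases ?_ (fun i => ?_) i
      · rw [Function.update_of_ne (Fin.succ_ne_zero j).symm]; simp [row, shearP]
      · by_cases hij : i = j
        · subst hij
          simp [row, shearP, h, hCt]
          ring
        · simp [row, shearP, h, hij, Function.update_of_ne]

lemma mem_rho {I : Ideal R} {s : R} {x : R[X]} (hx : rho (I ⊔ Ideal.span {s}) x = 0) :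
    ∃ y, rho I x = C (Ideal.Quotient.mk I s) * y := by
  have h1 : rho I x ∈ Ideal.map C (Ideal.span {Ideal.Quotient.mk I s}) := by
    rw [Ideal.mem_map_C_iff]
    intro k
    have h2 : (rho (I ⊔ Ideal.span {s}) x).coeff k = 0 := by rw [hx]; simp
    simp only [rho, coe_mapRingHom, coeff_map] at h2 ⊢
    rw [Ideal.Quotient.eq_zero_iff_mem, Submodule.mem_sup] at h2
    obtain ⟨a, ha, b, hb, hab⟩ := h2
    rw [← hab, map_add, Ideal.Quotient.eq_zero_iff_mem.mpr ha, zero_add]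
    rw [Ideal.mem_span_singleton] at hb ⊢
    exact map_dvd _ hb
  rw [Ideal.map_span, Set.image_singleton, Ideal.mem_span_singleton] at h1
  exact h1

theorem Pstep {m : ℕ} (hOm : Om R P (m+2)) (n : ℕ) (hn : n ≤ m + 2) :
    ∀ (I : Ideal R), ringKrullDim (R ⧸ I) < (n : ℕ) → ∀ (v : P × R[X]) (Φ : (P × R[X]) →ₗ[R[X]] R[X]),
      rho I (Φ v) = 1 → ∃ g : (P × R[X]) ≃ₗ[R[X]] (P × R[X]),
        ∀ φ : (P × R[X]) →ₗ[R[X]] R[X], rho I (φ (g v)) = rho I (φ (0, 1)) := by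
  induction n with
  | zero =>
    intro I hI v Φ _
    refine ⟨LinearEquiv.refl _ _, fun φ => ?_⟩
    have : Subsingleton (R ⧸ I) := by
      by_contra hh
      rw [not_subsingleton_iff_nontrivial] at hh
      have := ringKrullDim_nonneg_of_nontrivial (R := R ⧸ I)
      exact absurd hI (not_lt.mpr (by simpa using this))
    exact Subsingleton.elim _ _
  | succ n ih =>
    intro I hI v Φ hΦ
    obtain ⟨t, ht, e, ψ, h1, h2⟩ := hOm I
    have hdim2 : ringKrullDim (R ⧸ I) < (m + 2 : ℕ) := lt_of_lt_of_le hI (by exact_mod_cast hn)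
    set J := I ⊔ Ideal.span {t ^ 4} with hJ
    have hJd : ringKrullDim (R ⧸ J) < (n : ℕ) := by
      have h4 : Ideal.Quotient.mk I (t ^ 4) ∈ nonZeroDivisors (R ⧸ I) := by
        rw [map_pow]; exact pow_mem ht 4
      have e1 := DoubleQuot.quotQuotEquivQuotSup I (Ideal.span {t ^ 4})
      rw [Ideal.map_span, Set.image_singleton] at e1
      rw [hJ, ← ringKrullDim_eq_of_ringEquiv e1]
      exact lt_of_succ_le (ringKrullDim_quotient_succ_le_of_nonZeroDivisor h4) hI
    have hle : I ≤ J := le_sup_left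
    have hfac : ∀ x, rho I x = 1 → rho J x = 1 := by
      intro x hx
      have : rho J x = mapRingHom (Ideal.Quotient.factor hle) (rho I x) := by
        simp only [rho, coe_mapRingHom, Polynomial.map_map, Ideal.Quotient.factor_comp_mk]
      rw [this, hx, map_one]
    obtain ⟨g, hg⟩ := ih (by omega) J hJd v Φ (hfac _ hΦ)
    obtain ⟨⟨q, a⟩, hqa⟩ : ∃ w, w = g v := ⟨_, rfl⟩
    rw [← hqa] at hg
    have hτ : ∀ x, rho J x = 0 → ∃ y, rho I x = C (Ideal.Quotient.mk I t ^ 4) * y := by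
      intro x hx
      rw [← map_pow]
      exact mem_rho hx
    obtain ⟨b, hb⟩ := hτ (a - 1) (by
      have := hg (LinearMap.snd _ _ _)
      simp only [LinearMap.snd_apply] at this
      rw [map_sub, this, sub_self])
    have hq : ∀ i, ∃ y, rho I (ψ i q) = C (Ideal.Quotient.mk I t ^ 4) * y := by
      intro i
      apply hτ
      have := hg ((ψ i).comp (LinearMap.fst _ _ _))
      simpa using this
    choose y hy using hq
    have hrow : row I ψ (q, a) = (Pi.single 0 1 : Fin (m+3) → (R ⧸ I)[X]) +
        C (Ideal.Quotient.mk I t ^ 4) • (Fin.cons b y : Fin (m+3) → (R ⧸ I)[X]) := by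
      ext1 i
      refine Fin.cases ?_ (fun i => ?_) i
      · simp only [row, Fin.cons_zero, Pi.add_apply, Pi.single_eq_same, Pi.smul_apply, smul_eq_mul]
        rw [← hb, map_sub, map_one]; ring
      · simp only [row, Fin.cons_succ, Pi.add_apply, Pi.smul_apply, smul_eq_mul, hy]
        rw [Pi.single_eq_of_ne (Fin.succ_ne_zero i), zero_add]
    have hum : Um (row I ψ (q, a)) := by
      let Ψ := Φ.comp g.symm.toLinearMap
      have hΨ : rho I (Ψ (q, a)) = 1 := by
        rw [hqa]; simp only [Ψ, LinearMap.comp_apply, LinearEquiv.coe_coe, LinearEquiv.symm_apply_apply]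
        exact hΦ
      let Ψ1 := Ψ.comp (LinearMap.inl _ _ _)
      have e1 : Ψ (q, a) = Ψ1 q + a * Ψ (0, 1) := by
        have : ((q, a) : P × R[X]) = (q, 0) + a • ((0, 1) : P × R[X]) := by simp
        rw [this, map_add, map_smul]; rfl
      rw [e1, map_add, map_mul] at hΨ
      have e2 := h2 q Ψ1
      set T : (R ⧸ I)[X] := C (Ideal.Quotient.mk I t) with hT
      have hb' : rho I a = 1 + T ^ 4 * b := by
        rw [hT, ← map_pow, ← hb, map_sub, map_one]; ring
      refine ⟨Fin.cons (1 - T ^ 4 * b * rho I (Ψ (0, 1))) (fun i => - T ^ 3 * b * rho I (Ψ1 (e i))), ?_⟩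
      rw [Fin.sum_univ_succ]
      simp only [row, Fin.cons_zero, Fin.cons_succ]
      have e3 : ∑ i, - T ^ 3 * b * rho I (Ψ1 (e i)) * rho I (ψ i q) =
          - T ^ 3 * b * (T * rho I (Ψ1 q)) := by
        rw [e2, Finset.mul_sum]
        exact Finset.sum_congr rfl fun i _ => by ring
      rw [e3]
      linear_combination hb' - T ^ 4 * b * hΨ
    rw [hrow] at hum
    obtain ⟨E, hE, hE'⟩ := relative hdim2 _ _ hum
    rw [← hrow] at hE'
    obtain ⟨G, hG⟩ := lift_mat I t e ψ h1 E hE (q, a)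
    rw [hE'] at hG
    refine ⟨g.trans G, fun φ => ?_⟩
    rw [LinearEquiv.trans_apply, ← hqa]
    obtain ⟨⟨q', a'⟩, hqa'⟩ : ∃ w, w = G (q, a) := ⟨_, rfl⟩
    rw [← hqa'] at hG ⊢
    have ha' : rho I a' = 1 := by
      have := congrFun hG 0
      simpa [row] using this
    have hq' : ∀ i, rho I (ψ i q') = 0 := by
      intro i
      have := congrFun hG i.succ
      simpa [row] using this
    have e1 : φ (q', a') = (φ.comp (LinearMap.inl _ _ _)) q' + a' * φ (0, 1) := by
      have : ((q', a') : P × R[X]) = (q', 0) + a' • ((0, 1) : P × R[X]) := by simp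
      rw [this, map_add, map_smul]; rfl
    have e2 := h2 q' (φ.comp (LinearMap.inl _ _ _))
    simp only [hq', zero_mul, Finset.sum_const_zero] at e2
    have e3 : rho I ((φ.comp (LinearMap.inl _ _ _)) q') = 0 := by
      ext k
      have := congrArg (fun p => coeff p k) e2
      simp only [coeff_C_mul, coeff_zero] at this ⊢
      exact (mul_left_mem_nonZeroDivisors_eq_zero_iff ht).mp this
    rw [e1, map_add, e3, map_mul, ha', one_mul, zero_add]

end
end YC

namespace YC
set_option linter.unusedSectionVars false
set_option linter.unusedSimpArgs false

lemma unif {ι X : Type*} [Fintype ι] (Q : ι → ℕ → X → Prop)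
    (h : ∀ i, ∃ k x, Q i k x) (up : ∀ i k x j, Q i k x → ∃ x', Q i (k + j) x') :
    ∃ k, ∃ x : ι → X, ∀ i, Q i k (x i) := by
  choose k x hx using h
  refine ⟨∑ i, k i, ?_⟩
  have : ∀ i, ∃ x', Q i (∑ i, k i) x' := by
    intro i
    have hle : k i ≤ ∑ i, k i := Finset.single_le_sum (fun _ _ => Nat.zero_le _) (Finset.mem_univ i)
    obtain ⟨j, hj⟩ := Nat.exists_eq_add_of_le hle
    rw [hj]
    exact up _ _ _ _ (hx i)
  choose y hy using this
  exact ⟨y, hy⟩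

theorem clear_den {A L P N : Type*} [CommRing A] [CommRing L] [Algebra A L]
    [AddCommGroup P] [Module A P] [Module.Finite A P] [Module.Projective A P]
    [AddCommGroup N] [Module A N] [Module L N] [IsScalarTower A L N]
    (K : Ideal A) (s : A) (hs : ∀ x, s * x ∈ K → x ∈ K) (f : P →ₗ[A] N)
    (hf0 : ∀ q, f q = 0 → ∃ k, s ^ k • q ∈ (K • ⊤ : Submodule A P))
    (hf1 : ∀ y, ∃ (k : ℕ) (q : P), s ^ k • y = f q)
    (hL0 : ∀ x, algebraMap A L x = 0 → x ∈ K)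
    (hL1 : ∀ y : L, ∃ (k : ℕ) (x : A), s ^ k • y = algebraMap A L x)
    {r : ℕ} (b : Module.Basis (Fin r) L N) :
    ∃ (k : ℕ) (e : Fin r → P) (ψ : Fin r → (P →ₗ[A] A)),
      (∀ i j, ψ i (e j) - (if i = j then s ^ k else 0) ∈ K) ∧
      ∀ (q : P) (φ : P →ₗ[A] A), s ^ k * φ q - ∑ i, ψ i q * φ (e i) ∈ K := by
  have hs' : ∀ k x, s ^ k * x ∈ K → x ∈ K := by
    intro k
    induction k with
    | zero => intro x hx; simpa using hx
    | succ k ih => intro x hx; exact ih _ (hs _ (by rw [← mul_assoc, ← pow_succ']; exact hx))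
  obtain ⟨a, e, he⟩ := unif (fun (i : Fin r) (k : ℕ) (q : P) => s ^ k • b i = f q)
    (fun i => hf1 (b i)) (fun i k x j h => ⟨s ^ j • x, by
      rw [map_smul, ← h, smul_smul, ← pow_add, add_comm k j]⟩)
  obtain ⟨n, π, ι, hπ, hι, hπι⟩ := Module.Finite.exists_comp_eq_id_of_projective A P
  let x : Fin n → P := fun l => π (Pi.single l 1)
  have hx : ∀ q, q = ∑ l, ι q l • x l := by
    intro q
    have h1 : π (ι q) = q := LinearMap.congr_fun hπι q
    have h2 : ι q = ∑ l, ι q l • (Pi.single l 1 : Fin n → A) := pi_eq_sum_univ' (ι q)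
    conv_lhs => rw [← h1, h2, map_sum]
    simp only [map_smul, x]
  obtain ⟨c, y, hy⟩ := unif (fun (p : Fin r × Fin n) (k : ℕ) (z : A) =>
      s ^ k • b.repr (f (x p.2)) p.1 = algebraMap A L z)
    (fun p => hL1 _) (fun i k x j h => ⟨s ^ j • x, by
      rw [smul_eq_mul, map_mul, ← h, ← Algebra.smul_def, smul_smul, ← pow_add, add_comm k j]⟩)
  let ψ : Fin r → (P →ₗ[A] A) := fun i =>
    ∑ l, (y (i, l)) • ((LinearMap.proj l : (Fin n → A) →ₗ[A] A).comp ι)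
  have hψ : ∀ i q, algebraMap A L (ψ i q) = s ^ c • b.repr (f q) i := by
    intro i q
    conv_rhs => rw [hx q]
    simp only [ψ, LinearMap.sum_apply, LinearMap.smul_apply, LinearMap.comp_apply,
      LinearMap.proj_apply, map_sum, smul_eq_mul, map_mul, map_smul]
    rw [Finsupp.finsetSum_apply, Finset.smul_sum]
    refine Finset.sum_congr rfl fun l _ => ?_
    rw [← hy (i, l)]
    have : b.repr (ι q l • f (x l)) i = ι q l • b.repr (f (x l)) i := by
      rw [← algebraMap_smul L (ι q l) (f (x l)), map_smul, Finsupp.smul_apply, algebraMap_smul]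
    rw [this, mul_comm, ← Algebra.smul_def, smul_comm]
  refine ⟨c + a, e, ψ, ?_, ?_⟩
  · intro i j
    apply hL0
    rw [map_sub, hψ, ← he j]
    have : b.repr (s ^ a • b j) i = s ^ a • (if i = j then 1 else 0) := by
      rw [← algebraMap_smul L (s ^ a) (b j), map_smul, Finsupp.smul_apply, algebraMap_smul,
        b.repr_self, Finsupp.single_apply]
      simp only [eq_comm]
    rw [this, smul_smul, ← pow_add]
    split_ifs
    · rw [Algebra.smul_def, mul_one, sub_self]
    · simp
  · intro q φ
    have h0 : f (s ^ (c + a) • q - ∑ i, ψ i q • e i) = 0 := by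
      rw [map_sub, map_sum, map_smul, sub_eq_zero]
      conv_lhs => rw [← b.sum_repr (f q)]
      rw [Finset.smul_sum]
      refine Finset.sum_congr rfl fun i _ => ?_
      rw [map_smul, ← he i, ← algebraMap_smul L (ψ i q), hψ, smul_assoc, pow_add, mul_smul,
        smul_comm _ (s ^ a) (b i)]
    obtain ⟨k, hk⟩ := hf0 _ h0
    have h1 : φ (s ^ k • (s ^ (c + a) • q - ∑ i, ψ i q • e i)) ∈ K := by
      have : (K • ⊤ : Submodule A P) ≤ Submodule.comap φ K := by
        rw [Submodule.smul_le]
        intro u hu p _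
        simp only [Submodule.mem_comap, map_smul, smul_eq_mul]
        exact Ideal.mul_mem_right _ _ hu
      exact this hk
    rw [map_smul, smul_eq_mul] at h1
    have := hs' k _ h1
    simpa [map_sub, map_sum] using this

lemma bc_quot {A P : Type*} [CommRing A] [AddCommGroup P] [Module A P] (K : Ideal A) :
    IsBaseChange (A ⧸ K) (Submodule.mkQ (K • ⊤ : Submodule A P)) := by
  refine IsBaseChange.of_equiv
    ((TensorProduct.quotTensorEquivQuotSMul P K).extendScalarsOfSurjective
      Ideal.Quotient.mk_surjective) ?_
  intro x
  simp
end YC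

namespace YC
set_option linter.unusedSectionVars false
set_option linter.unusedSimpArgs false

lemma rho_zero_iff {R : Type*} [CommRing R] (I : Ideal R) (x : R[X]) :
    rho I x = 0 ↔ x ∈ I.map (algebraMap R R[X]) := by
  rw [algebraMap_eq, Ideal.mem_map_C_iff, Polynomial.ext_iff]
  simp only [rho, coe_mapRingHom, coeff_map, coeff_zero, Ideal.Quotient.eq_zero_iff_mem]

theorem loc_free {A B P N : Type*} [CommRing A] [CommRing B] [Algebra A B]
    [AddCommGroup P] [Module A P] [Module.Finite A P] [Module.Projective A P]
    [AddCommGroup N] [Module A N] [Module B N] [IsScalarTower A B N]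
    (K : Ideal A) (hB : Function.Surjective (algebraMap A B))
    (hBK : ∀ x, algebraMap A B x = 0 ↔ x ∈ K)
    (g : P →ₗ[A] N) (hg : IsBaseChange B g) (hgs : Function.Surjective g)
    (hgK : ∀ q, g q = 0 → q ∈ (K • ⊤ : Submodule A P))
    (s : A) (σ : B) (hσ : σ = algebraMap A B s) (hsK : ∀ x, s * x ∈ K → x ∈ K)
    (hK1 : (1 : A) ∉ K) (r : ℕ) (hrank : ∀ p, Module.rankAtStalk (R := A) P p = r)
    (hfree : Module.Free (Localization (Submonoid.powers σ))
      (LocalizedModule (Submonoid.powers σ) N)) :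
    ∃ (k : ℕ) (e : Fin r → P) (ψ : Fin r → (P →ₗ[A] A)),
      (∀ i j, ψ i (e j) - (if i = j then s ^ k else 0) ∈ K) ∧
      ∀ (q : P) (φ : P →ₗ[A] A), s ^ k * φ q - ∑ i, ψ i q * φ (e i) ∈ K := by
  obtain ⟨S, hS⟩ : ∃ S, S = Submonoid.powers σ := ⟨_, rfl⟩
  rw [← hS] at hfree
  have hS1 : ∀ x : S, ∃ k, (x : B) = algebraMap A B (s ^ k) := by
    rintro ⟨x, hx⟩
    rw [hS] at hx
    obtain ⟨k, rfl⟩ := hx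
    exact ⟨k, by rw [map_pow, ← hσ]⟩
  have hsK' : ∀ k x, s ^ k * x ∈ K → x ∈ K := by
    intro k
    induction k with
    | zero => intro x hx; simpa using hx
    | succ k ih => intro x hx; exact ih _ (hsK _ (by rw [← mul_assoc, ← pow_succ']; exact hx))
  let f : P →ₗ[A] LocalizedModule S N :=
    ((LocalizedModule.mkLinearMap S N).restrictScalars A).comp g
  have hbc : IsBaseChange (Localization S) f :=
    hg.comp (IsLocalizedModule.isBaseChange S (Localization S)
      (LocalizedModule.mkLinearMap S N))
  have hL0 : ∀ x : A, algebraMap A (Localization S) x = 0 → x ∈ K := by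
    intro x hx
    rw [IsScalarTower.algebraMap_apply A B (Localization S)] at hx
    obtain ⟨c, hk⟩ := (IsLocalization.map_eq_zero_iff S _ _).mp hx
    obtain ⟨k, hc⟩ := hS1 c
    apply hsK' k
    rw [← hBK, map_mul, ← hc]
    exact hk
  have hntL : Nontrivial (Localization S) := by
    by_contra hh
    rw [not_nontrivial_iff_subsingleton] at hh
    exact hK1 (hL0 1 (Subsingleton.elim _ _))
  have hfin : Module.Finite (Localization S) (LocalizedModule S N) :=
    Module.Finite.of_surjective hbc.equiv.toLinearMap hbc.equiv.surjective
  have hr : Module.finrank (Localization S) (LocalizedModule S N) = r := by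
    obtain ⟨p⟩ := (inferInstance : Nonempty (PrimeSpectrum (Localization S)))
    have h1 := Module.rankAtStalk_isBaseChange hbc p
    rw [Module.rankAtStalk_eq_finrank_of_free, hrank] at h1
    exact h1
  exact clear_den (L := Localization S) K s hsK f
    (by
      intro q hq
      have hq' : LocalizedModule.mkLinearMap S N (g q) = 0 := hq
      rw [IsLocalizedModule.eq_zero_iff S] at hq'
      obtain ⟨c, hk⟩ := hq'
      obtain ⟨k, hc⟩ := hS1 c
      refine ⟨k, hgK _ ?_⟩
      rw [map_smul, ← algebraMap_smul B (s ^ k), ← hc]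
      exact hk)
    (by
      intro y
      obtain ⟨⟨m, c⟩, hm⟩ := IsLocalizedModule.surj S (LocalizedModule.mkLinearMap S N) y
      obtain ⟨k, hc⟩ := hS1 c
      obtain ⟨q, rfl⟩ := hgs m
      refine ⟨k, q, ?_⟩
      rw [← algebraMap_smul B (s ^ k) y, ← hc]
      exact hm)
    hL0
    (by
      intro y
      obtain ⟨⟨m, c⟩, hm⟩ := IsLocalization.surj S y
      obtain ⟨k, hc⟩ := hS1 c
      obtain ⟨q, rfl⟩ := hB m
      refine ⟨k, q, ?_⟩
      rw [Algebra.smul_def, mul_comm, IsScalarTower.algebraMap_apply A B (Localization S),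
        IsScalarTower.algebraMap_apply A B (Localization S), ← hc]
      exact hm)
    (Module.finBasisOfFinrankEq _ _ hr)

theorem Om_of {R : Type*} [CommRing R] {P : Type*} [AddCommGroup P] [Module R[X] P]
    [Module.Finite R[X] P] [Module.Projective R[X] P] (r : ℕ)
    (hrank : HasConstantRank R[X] P r) (hΩ : PropertyOmega R R[X] P) : Om R P r := by
  intro I
  by_cases hI : I = ⊤
  · have : Subsingleton (R ⧸ I) := Ideal.Quotient.subsingleton_iff.mpr hI
    refine ⟨1, by rw [map_one]; exact one_mem _, 0, 0, fun _ _ => Subsingleton.elim _ _,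
      fun _ _ => Subsingleton.elim _ _⟩
  have hnt : Nontrivial (R ⧸ I) := Ideal.Quotient.nontrivial_iff.mpr hI
  obtain ⟨t, ht, hfree⟩ := hΩ I
  have hsK : ∀ x, algebraMap R R[X] t * x ∈ I.map (algebraMap R R[X]) →
      x ∈ I.map (algebraMap R R[X]) := by
    intro x hx
    rw [← rho_zero_iff] at hx ⊢
    rw [map_mul] at hx
    have e : rho I (algebraMap R R[X] t) = C (Ideal.Quotient.mk I t) := by simp [rho]
    rw [e] at hx
    ext k
    have := congrArg (fun p => coeff p k) hx
    simp only [coeff_C_mul, coeff_zero] at this ⊢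
    exact (mul_left_mem_nonZeroDivisors_eq_zero_iff ht).mp this
  have hK1 : (1 : R[X]) ∉ I.map (algebraMap R R[X]) := by
    rw [← rho_zero_iff, map_one]; exact one_ne_zero
  obtain ⟨k, e, ψ, h1, h2⟩ := loc_free (I.map (algebraMap R R[X]))
    Ideal.Quotient.mk_surjective (fun x => Ideal.Quotient.eq_zero_iff_mem) _
    (bc_quot (P := P) (I.map (algebraMap R R[X]))) (Submodule.mkQ_surjective _)
    (fun q hq => (Submodule.Quotient.mk_eq_zero _).mp hq) (algebraMap R R[X] t) _ rfl hsK hK1 r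
    (fun p => (hrank p.asIdeal p.isPrime).2) hfree
  have hsk : rho I (algebraMap R R[X] t ^ k) = C (Ideal.Quotient.mk I (t ^ k)) := by
    rw [map_pow, map_pow, map_pow]; simp [rho]
  refine ⟨t ^ k, by rw [map_pow]; exact pow_mem ht k, e, ψ, fun i j => ?_, fun q φ => ?_⟩
  · have := (rho_zero_iff I _).mpr (h1 i j)
    rw [map_sub, sub_eq_zero] at this
    rw [this]
    split_ifs
    · exact hsk
    · simp
  · have := (rho_zero_iff I _).mpr (h2 q φ)
    rw [map_sub, sub_eq_zero, map_mul, hsk, map_sum] at this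
    rw [this]
    simp only [map_mul]
end YC

namespace YC
set_option linter.unusedSectionVars false
set_option linter.unusedSimpArgs false

lemma sep {A P : Type*} [CommRing A] [AddCommGroup P] [Module A P] [Module.Finite A P]
    [Module.Projective A P] {x y : P} (h : ∀ φ : P →ₗ[A] A, φ x = φ y) : x = y := by
  obtain ⟨n, π, ι, hπ, hι, hπι⟩ := Module.Finite.exists_comp_eq_id_of_projective A P
  apply hι
  ext l
  exact h ((LinearMap.proj l).comp ι)

lemma cancel_norm {A P Q : Type*} [CommRing A] [AddCommGroup P] [Module A P] [AddCommGroup Q]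
    [Module A Q] (η : (P × A) ≃ₗ[A] (Q × A)) (h : η (0, 1) = (0, 1)) : Nonempty (P ≃ₗ[A] Q) := by
  have h' : η.symm (0, 1) = (0, 1) := by rw [← h, η.symm_apply_apply]
  refine ⟨{ (LinearMap.fst A Q A).comp (η.toLinearMap.comp (LinearMap.inl A P A)) with
    invFun := fun q => (η.symm (q, 0)).1
    left_inv := ?_
    right_inv := ?_ }⟩
  · intro p
    show (η.symm ((η (p, 0)).1, 0)).1 = p
    have : ((η (p, 0)).1, (0 : A)) = η (p, 0) - (η (p, 0)).2 • ((0, 1) : Q × A) := by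
      ext <;> simp
    rw [this, map_sub, map_smul, h', η.symm_apply_apply]
    simp
  · intro q
    show (η ((η.symm (q, 0)).1, 0)).1 = q
    have : ((η.symm (q, 0)).1, (0 : A)) = η.symm (q, 0) - (η.symm (q, 0)).2 • ((0, 1) : P × A) := by
      ext <;> simp
    rw [this, map_sub, map_smul, h, η.apply_symm_apply]
    simp

lemma rho_bot {R : Type*} [CommRing R] {x y : R[X]} (h : rho (⊥ : Ideal R) x = rho ⊥ y) : x = y := by
  rw [← sub_eq_zero, ← map_sub, rho_zero_iff, Ideal.map_bot, Ideal.mem_bot, sub_eq_zero] at h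
  exact h

theorem cancel_one {R : Type*} [CommRing R] {P Q : Type*} [AddCommGroup P] [Module R[X] P]
    [Module.Finite R[X] P] [Module.Projective R[X] P] [AddCommGroup Q] [Module R[X] Q]
    {m : ℕ} (hOm : Om R P (m + 2)) (hdim : ringKrullDim R < (m + 2 : ℕ))
    (θ : (P × R[X]) ≃ₗ[R[X]] (Q × R[X])) : Nonempty (P ≃ₗ[R[X]] Q) := by
  have hd : ringKrullDim (R ⧸ (⊥ : Ideal R)) < (m + 2 : ℕ) := by
    rw [ringKrullDim_eq_of_ringEquiv (RingEquiv.quotientBot R)]; exact hdim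
  obtain ⟨g, hg⟩ := Pstep hOm (m + 2) le_rfl ⊥ hd (θ.symm (0, 1))
    ((LinearMap.snd _ _ _).comp θ.toLinearMap) (by simp)
  have hg' : g (θ.symm (0, 1)) = (0, 1) := sep fun φ => rho_bot (hg φ)
  refine cancel_norm (g.symm.trans θ) ?_
  rw [LinearEquiv.trans_apply, ← hg', g.symm_apply_apply, θ.apply_symm_apply]

lemma Om_equiv {R : Type*} [CommRing R] {P Q : Type*} [AddCommGroup P] [Module R[X] P]
    [AddCommGroup Q] [Module R[X] Q] {r : ℕ} (h : Om R P r) (ε : P ≃ₗ[R[X]] Q) : Om R Q r := by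
  intro I
  obtain ⟨t, ht, e, ψ, h1, h2⟩ := h I
  refine ⟨t, ht, fun i => ε (e i), fun i => (ψ i).comp ε.symm.toLinearMap, fun i j => ?_,
    fun q φ => ?_⟩
  · simpa using h1 i j
  · have := h2 (ε.symm q) (φ.comp ε.toLinearMap)
    simpa using this

lemma Om_succ {R : Type*} [CommRing R] {P : Type*} [AddCommGroup P] [Module R[X] P]
    {r : ℕ} (h : Om R P r) : Om R (P × R[X]) (r + 1) := by
  intro I
  obtain ⟨t, ht, e, ψ, h1, h2⟩ := h I
  have hCt : rho I (C t) = C (Ideal.Quotient.mk I t) := by simp [rho]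
  refine ⟨t, ht, Fin.cons (0, C t) (fun i => (e i, 0)),
    Fin.cons (LinearMap.snd _ _ _) (fun i => (ψ i).comp (LinearMap.fst _ _ _)), fun i j => ?_,
    fun q φ => ?_⟩
  · refine Fin.cases ?_ (fun i => ?_) i <;> refine Fin.cases ?_ (fun j => ?_) j
    · simp [hCt]
    · simp [(Fin.succ_ne_zero _).symm]
    · simp
    · simpa using h1 i j
  · obtain ⟨q, a⟩ := q
    have e1 : φ (q, a) = (φ.comp (LinearMap.inl _ _ _)) q + a * φ (0, 1) := by
      have : ((q, a) : P × R[X]) = (q, 0) + a • ((0, 1) : P × R[X]) := by simp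
      rw [this, map_add, map_smul]; rfl
    have e2 : φ (0, C t) = C t * φ (0, 1) := by
      have : ((0, C t) : P × R[X]) = C t • ((0, 1) : P × R[X]) := by simp
      rw [this, map_smul]; rfl
    rw [Fin.sum_univ_succ]
    simp only [Fin.cons_zero, Fin.cons_succ, LinearMap.snd_apply, LinearMap.comp_apply,
      LinearMap.fst_apply]
    have := h2 q (φ.comp (LinearMap.inl _ _ _))
    simp only [LinearMap.comp_apply, LinearMap.inl_apply] at this e1
    rw [e1, map_add, mul_add, this, e2, map_mul, map_mul, hCt]
    ring

/-- splitting off one coordinate -/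
noncomputable def splitE (A P : Type*) [CommRing A] [AddCommGroup P] [Module A P] (t : ℕ) :
    ((P × (Fin t → A)) × A) ≃ₗ[A] (P × (Fin (t + 1) → A)) where
  toFun v := (v.1.1, Fin.cons v.2 v.1.2)
  invFun v := ((v.1, Fin.tail v.2), v.2 0)
  left_inv v := by simp
  right_inv v := by simp
  map_add' v w := by
    ext1
    · rfl
    · ext1 i
      refine Fin.cases ?_ (fun i => ?_) i <;> simp
  map_smul' c v := by
    ext1
    · rfl
    · ext1 i
      refine Fin.cases ?_ (fun i => ?_) i <;> simp

def zeroE (A P : Type*) [CommRing A] [AddCommGroup P] [Module A P] :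
    P ≃ₗ[A] (P × (Fin 0 → A)) where
  toFun v := (v, 0)
  invFun v := v.1
  left_inv v := rfl
  right_inv v := Prod.ext rfl (Subsingleton.elim _ _)
  map_add' v w := by simp
  map_smul' c v := by simp

lemma Om_free {R : Type*} [CommRing R] {P : Type*} [AddCommGroup P] [Module R[X] P]
    {r : ℕ} (h : Om R P r) (t : ℕ) : Om R (P × (Fin t → R[X])) (r + t) := by
  induction t with
  | zero => exact Om_equiv h (zeroE _ _)
  | succ t ih => exact Om_equiv (Om_succ ih) (splitE _ _ t)

lemma cancel_free {A Q : Type*} [CommRing A] [AddCommGroup Q] [Module A Q]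
    (θ : (A × A) ≃ₗ[A] (Q × A)) : Nonempty (A ≃ₗ[A] Q) := by
  obtain ⟨⟨x, y⟩, hv⟩ : ∃ v, v = θ.symm (0, 1) := ⟨_, rfl⟩
  have hv' : θ (x, y) = (0, 1) := by rw [hv, θ.apply_symm_apply]
  set α := (θ (1, 0)).2
  set β := (θ (0, 1)).2
  have h1 : x * α + y * β = 1 := by
    have : ((x, y) : A × A) = x • ((1, 0) : A × A) + y • ((0, 1) : A × A) := by simp
    rw [this, map_add, map_smul, map_smul] at hv'
    exact congrArg Prod.snd hv'
  let g : (A × A) ≃ₗ[A] (A × A) :=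
    { toFun := fun v => (β * v.1 + x * v.2, - α * v.1 + y * v.2)
      invFun := fun v => (y * v.1 - x * v.2, α * v.1 + β * v.2)
      left_inv := by
        rintro ⟨p, q⟩
        ext
        · show y * (β * p + x * q) - x * (-α * p + y * q) = p
          linear_combination p * h1
        · show α * (β * p + x * q) + β * (-α * p + y * q) = q
          linear_combination q * h1
      right_inv := by
        rintro ⟨p, q⟩
        ext
        · show β * (y * p - x * q) + x * (α * p + β * q) = p
          linear_combination p * h1
        · show -α * (y * p - x * q) + y * (α * p + β * q) = q
          linear_combination q * h1
      map_add' := by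
        rintro ⟨p, q⟩ ⟨p', q'⟩
        ext
        · simp; ring
        · simp; ring
      map_smul' := by
        rintro c ⟨p, q⟩
        ext
        · simp; ring
        · simp; ring }
  refine cancel_norm (g.trans θ) ?_
  rw [LinearEquiv.trans_apply]
  have : g (0, 1) = (x, y) := by
    show (β * 0 + x * 1, - α * 0 + y * 1) = (x, y)
    simp
  rw [this, hv']

lemma rank_one {R : Type*} [CommRing R] (hdim : ringKrullDim R < (1 : ℕ)) {P : Type*}
    [AddCommGroup P] [Module R[X] P] [Module.Finite R[X] P] [Module.Projective R[X] P]
    (h : Om R P 1) : Nonempty (P ≃ₗ[R[X]] R[X]) := by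
  obtain ⟨t, ht, e, ψ, h1, h2⟩ := h ⊥
  have hu : IsUnit t := by
    have ht' : t ∈ nonZeroDivisors R := by
      rw [mem_nonZeroDivisors_iff_right]
      intro x hx
      have := (mul_right_mem_nonZeroDivisors_eq_zero_iff ht).mp
        (show Ideal.Quotient.mk (⊥ : Ideal R) x * Ideal.Quotient.mk ⊥ t = 0 by rw [← map_mul, hx, map_zero])
      rw [Ideal.Quotient.eq_zero_iff_mem, Ideal.mem_bot] at this
      exact this
    have hlt := lt_of_succ_le (n := 0) (ringKrullDim_quotient_succ_le_of_nonZeroDivisor ht') hdim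
    have : Subsingleton (R ⧸ Ideal.span {t}) := by
      by_contra hh
      rw [not_subsingleton_iff_nontrivial] at hh
      have := ringKrullDim_nonneg_of_nontrivial (R := R ⧸ Ideal.span {t})
      exact absurd hlt (not_lt.mpr (by simpa using this))
    rw [Ideal.Quotient.subsingleton_iff, Ideal.span_singleton_eq_top] at this
    exact this
  obtain ⟨t', htt⟩ := hu.exists_right_inv
  have hCt : rho ⊥ (C t) = C (Ideal.Quotient.mk ⊥ t) := by simp [rho]
  have h1' : ψ 0 (e 0) = C t := by
    apply rho_bot
    rw [h1 0 0, hCt]; simp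
  have h2' : ∀ q, C t • q = ψ 0 q • e 0 := by
    intro q
    refine sep (A := R[X]) fun φ => rho_bot (R := R) ?_
    have := h2 q φ
    simp only [Finset.univ_unique, Fin.default_eq_zero, Finset.sum_singleton] at this
    rw [φ.map_smul, φ.map_smul, smul_eq_mul, smul_eq_mul, map_mul, map_mul, hCt, this]
  have hc : (C t * C t' : R[X]) = 1 := by rw [← map_mul, htt, map_one]
  refine ⟨LinearEquiv.ofBijective (ψ 0) ⟨?_, ?_⟩⟩
  · rw [injective_iff_map_eq_zero]
    intro q hq
    have := h2' q
    rw [hq, zero_smul] at this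
    have h3 : (C t' * C t) • q = 0 := by rw [mul_smul, this, smul_zero]
    rwa [mul_comm, hc, one_smul] at h3
  · intro a
    refine ⟨(a * C t') • e 0, ?_⟩
    rw [map_smul, h1', smul_eq_mul]
    linear_combination a * hc

theorem final (R : Type*) [CommRing R] (d : ℕ) (hdim : ringKrullDim R = d)
    (P : Type*) [AddCommGroup P] [Module R[X] P]
    [Module.Finite R[X] P] [Module.Projective R[X] P]
    (r : ℕ) (hr : d + 1 ≤ r) (hOm : Om R P r)
    (Q : Type*) [AddCommGroup Q] [Module R[X] Q] (t : ℕ)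
    (h : Nonempty ((P × (Fin t → R[X])) ≃ₗ[R[X]] (Q × (Fin t → R[X])))) :
    Nonempty (P ≃ₗ[R[X]] Q) := by
  induction t with
  | zero =>
    obtain ⟨θ⟩ := h
    exact ⟨((zeroE _ P).trans θ).trans (zeroE _ Q).symm⟩
  | succ t ih =>
    obtain ⟨θ⟩ := h
    have θ' := ((splitE _ P t).trans θ).trans (splitE _ Q t).symm
    by_cases hrt : 2 ≤ r + t
    · apply ih
      obtain ⟨m, hm⟩ := Nat.exists_eq_add_of_le' hrt
      have h1 := Om_free hOm t
      rw [hm] at h1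
      refine cancel_one h1 ?_ θ'
      rw [hdim]
      exact_mod_cast (by omega : d < m + 2)
    · obtain rfl : r = 1 := by omega
      obtain rfl : t = 0 := by omega
      obtain rfl : d = 0 := by omega
      have hd : ringKrullDim R < (1 : ℕ) := by rw [hdim]; exact_mod_cast Nat.zero_lt_one
      obtain ⟨ε⟩ := rank_one hd hOm
      let θ2 : (R[X] × R[X]) ≃ₗ[R[X]] (Q × R[X]) :=
        (LinearEquiv.prodCongr (ε.symm.trans (zeroE _ P)) (LinearEquiv.refl _ _)).trans
          (θ'.trans (LinearEquiv.prodCongr (zeroE _ Q).symm (LinearEquiv.refl _ _)))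
      obtain ⟨ζ⟩ := cancel_free θ2
      exact ⟨ε.trans ζ⟩
end YC

/-- Let `R` be a commutative ring of finite Krull dimension `d` and
`A = R[Y]`. If `P` is a finitely generated projective `A`-module of constant rank
`r ≥ d + 1` satisfying property `Ω(R)`, then `P` is cancellative. -/
theorem statement_5 (R : Type*) [CommRing R] (d : ℕ) (hdim : ringKrullDim R = d)
    (P : Type*) [AddCommGroup P] [Module R[X] P]
    [Module.Finite R[X] P] [Module.Projective R[X] P]
    (r : ℕ) (hr : d + 1 ≤ r) (hrank : HasConstantRank R[X] P r)
    (hΩ : PropertyOmega R R[X] P) :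
    ∀ (Q : Type*) [AddCommGroup Q] [Module R[X] Q],
      Module.Finite R[X] Q → Module.Projective R[X] Q →
      ∀ t : ℕ, Nonempty ((P × (Fin t → R[X])) ≃ₗ[R[X]] (Q × (Fin t → R[X]))) →
        Nonempty (P ≃ₗ[R[X]] Q) := by
  intro Q _ _ _ _ t h
  exact YC.final R d hdim P r hr (YC.Om_of r hrank hΩ) Q t h
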